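/- arXiv:2104.13045 — 6 statements merged into one kernel-verified Lean document; each statement's English description precedes it below -/
import Mathlib

section
/- For every dimension d ∈ ℕ, d ≥ 1, there exists a constant C₀ > 0 such that for every nonzero multi-index β ∈ ℕ^d, every exponent 1 ≤ q ≤ ∞ and every t > 0, the spatial derivative of the heat kernel satisfies ‖D_x^β G(·,t)‖_{L^q(ℝ^d)} ≤ C₀^{|β|/2} (|β|/2)^{|β|/2 + (d/2)(1−1/q)} t^{−|β|/2 − (d/2)(1−1/q)}. -/
open MeasureTheory Real Filter
open scoped ENNReal BigOperators Topology

noncomputable section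

abbrev Euc (d : ℕ) : Type := EuclideanSpace ℝ (Fin d)

/-- The heat kernel on `ℝ^d`. -/
noncomputable def heatKernel (d : ℕ) (t : ℝ) (x : Euc d) : ℝ :=
  (4 * Real.pi * t) ^ (-(d : ℝ) / 2) * Real.exp (-‖x‖ ^ 2 / (4 * t))

/-- Partial derivative in the `i`-th coordinate direction. -/
noncomputable def pd {d : ℕ} {F : Type*} [NormedAddCommGroup F] [NormedSpace ℝ F]
    (i : Fin d) (f : Euc d → F) : Euc d → F :=
  fun x => fderiv ℝ f x (EuclideanSpace.single i 1)

/-- Multi-index spatial derivative `D_x^β`. -/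
noncomputable def mderiv {d : ℕ} {F : Type*} [NormedAddCommGroup F] [NormedSpace ℝ F]
    (β : Fin d → ℕ) (f : Euc d → F) : Euc d → F :=
  (List.finRange d).foldr (fun i g => (pd i)^[β i] g) f

/-- `k`-th time derivative (pointwise in space). -/
noncomputable def tderiv {d : ℕ} {F : Type*} [NormedAddCommGroup F] [NormedSpace ℝ F]
    (k : ℕ) (ρ : ℝ → Euc d → F) (t : ℝ) : Euc d → F :=
  fun x => iteratedDeriv k (fun s => ρ s x) t

/-- Convolution of two scalar functions on `ℝ^d`. -/
noncomputable def conv {d : ℕ} (f g : Euc d → ℝ) : Euc d → ℝ :=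
  fun x => ∫ y, f (x - y) * g y

/-- Convolution of a vector field with a scalar function on `ℝ^d`. -/
noncomputable def convV {d : ℕ} (f : Euc d → Euc d) (g : Euc d → ℝ) : Euc d → Euc d :=
  fun x => ∫ y, g y • f (x - y)

/-- Gradient of the heat kernel. -/
noncomputable def gradHeat (d : ℕ) (t : ℝ) : Euc d → Euc d :=
  gradient (fun x => heatKernel d t x)

/-- Gradient of the logarithmic potential `c` generated by `ρ`. -/
noncomputable def gradc (d : ℕ) (ρ : Euc d → ℝ) (x : Euc d) : Euc d :=
  (-(1 / (d * Real.pi))) • ∫ y, (ρ y / ‖x - y‖ ^ 2) • (x - y)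

/-- `|β|` for a multi-index. -/
def msize {d : ℕ} (β : Fin d → ℕ) : ℕ := ∑ i, β i

/-- The exponent `2d/(2d-1)` as an element of `ℝ≥0∞`. -/
noncomputable def qd (d : ℕ) : ℝ≥0∞ := (2 * d : ℝ≥0∞) / (2 * d - 1 : ℝ≥0∞)

/-- Right-hand side of the Duhamel formula for the mPKS equations. -/
noncomputable def mildRHS (d : ℕ) (ρ₀ : Euc d → ℝ) (ρ : ℝ → Euc d → ℝ) (t : ℝ) (x : Euc d) : ℝ :=
  conv (heatKernel d t) ρ₀ x -
    ∫ s in Set.Ioc (0:ℝ) t,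
      ∫ y, (inner ℝ (gradHeat d (t - s) (x - y)) (ρ s y • gradc d (ρ s) y) : ℝ)

/-- Mild solution of the mPKS equations on `[0,T]`. -/
def IsMildSolution (d : ℕ) (ρ₀ : Euc d → ℝ) (T : ℝ) (ρ : ℝ → Euc d → ℝ) : Prop :=
  ∀ t ∈ Set.Ioc (0:ℝ) T, ∀ x, ρ t x = mildRHS d ρ₀ ρ t x

/-- Membership in the space `X_T`. -/
def MemXT (d : ℕ) (T : ℝ) (ρ : ℝ → Euc d → ℝ) : Prop :=
  (∀ t ∈ Set.Ioc (0:ℝ) T, MemLp (ρ t) 1 volume) ∧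
  (∀ t ∈ Set.Ioc (0:ℝ) T,
    Filter.Tendsto (fun s => eLpNorm (fun x => ρ s x - ρ t x) 1 volume)
      (nhdsWithin t (Set.Ioc (0:ℝ) T)) (nhds 0)) ∧
  (∃ C : ℝ≥0∞, C ≠ ⊤ ∧ ∀ t ∈ Set.Ioc (0:ℝ) T, eLpNorm (ρ t) 1 volume ≤ C) ∧
  (∃ C : ℝ≥0∞, C ≠ ⊤ ∧ ∀ t ∈ Set.Ioc (0:ℝ) T,
    ENNReal.ofReal (t ^ (1/4 : ℝ)) * eLpNorm (ρ t) (qd d) volume ≤ C)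

/-- Assumption (𝒜): decay of the heat semigroup applied to `ρ₀`. -/
def AssumptionA (d : ℕ) (ρ₀ : Euc d → ℝ) (T θ : ℝ) : Prop :=
  ∀ q : ℝ≥0∞, 1 ≤ q → ∀ t ∈ Set.Ioc (0:ℝ) T,
    ENNReal.ofReal (t ^ (((d : ℝ) / 2) * (1 - q⁻¹.toReal))) *
      eLpNorm (conv (heatKernel d t) ρ₀) q volume ≤ ENNReal.ofReal θ


/-- the sequence of derivatives of the 1D Gaussian `exp (-(a/2) x^2)` -/
def hkU (a : ℝ) : ℕ → ℝ → ℝ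
  | 0 => fun x => Real.exp (-(a * x ^ 2 / 2))
  | 1 => fun x => -(a * x) * Real.exp (-(a * x ^ 2 / 2))
  | (n + 2) => fun x => -(a * x) * hkU a (n + 1) x - a * ((n : ℝ) + 1) * hkU a n x

lemma hkU_hasDerivAt (a : ℝ) (n : ℕ) :
    (∀ x, HasDerivAt (hkU a n) (hkU a (n + 1) x) x) ∧
    (∀ x, HasDerivAt (hkU a (n + 1)) (hkU a (n + 2) x) x) := by
  have h0 : ∀ x, HasDerivAt (hkU a 0) (hkU a 1 x) x := by
    intro x
    have h1 : HasDerivAt (fun x : ℝ => -(a * x ^ 2 / 2)) (-(a * x)) x := by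
      have := ((((hasDerivAt_id x).pow 2).const_mul a).div_const 2).neg
      refine this.congr_deriv ?_
      simp
      ring
    have := h1.exp
    refine HasDerivAt.congr_deriv this ?_
    simp only [hkU]
    ring
  have hl : ∀ x : ℝ, HasDerivAt (fun x : ℝ => -(a * x)) (-a) x := by
    intro x
    have := ((hasDerivAt_id x).const_mul a).neg
    refine this.congr_deriv ?_
    simp
  induction n with
  | zero =>
    refine ⟨h0, ?_⟩
    intro x
    have := (hl x).mul (h0 x)
    have e : hkU a (0 + 1) = (fun x : ℝ => -(a * x)) * hkU a 0 := by
      funext y; simp [hkU]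
    rw [e]
    refine this.congr_deriv ?_
    simp only [hkU]
    push_cast
    ring
  | succ n ih =>
    refine ⟨ih.2, ?_⟩
    intro x
    have := ((hl x).mul (ih.2 x)).sub ((ih.1 x).const_mul (a * ((n : ℝ) + 1)))
    have e : hkU a (n + 1 + 1) = ((fun x : ℝ => -(a * x)) * hkU a (n + 1))
        - fun y => a * ((n : ℝ) + 1) * hkU a n y := by
      funext y; simp [hkU]
    rw [e]
    refine this.congr_deriv ?_
    simp only [hkU]
    push_cast
    ring

lemma hkU_bound_aux (s : ℝ) (hs : 0 ≤ s) (x : ℝ) (n : ℕ) :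
    (|hkU (s ^ 2) n x| ≤ s ^ n * (s * |x| + √n) ^ n * Real.exp (-(s ^ 2 * x ^ 2 / 2))) ∧
    (|hkU (s ^ 2) (n + 1) x| ≤ s ^ (n + 1) * (s * |x| + √((n + 1 : ℕ) : ℝ)) ^ (n + 1)
      * Real.exp (-(s ^ 2 * x ^ 2 / 2))) := by
  set E := Real.exp (-(s ^ 2 * x ^ 2 / 2)) with hE
  have hE0 : 0 < E := Real.exp_pos _
  set y := s * |x| with hy
  have hy0 : 0 ≤ y := by positivity
  induction n with
  | zero =>
    constructor
    · simp [hkU, ← hE, abs_of_pos hE0]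
    · simp only [hkU, ← hE, abs_mul, abs_neg, abs_of_pos hE0]
      refine mul_le_mul_of_nonneg_right ?_ hE0.le
      rw [abs_of_nonneg (by positivity : 0 ≤ s ^ 2)]
      simp only [zero_add, pow_one, Nat.cast_one, Real.sqrt_one]
      have e : s ^ 2 * |x| = s * y := by rw [hy]; ring
      rw [e]
      gcongr
      linarith
  | succ n ih =>
    refine ⟨ih.2, ?_⟩
    have h1 := ih.1
    have h2 := ih.2
    set p := √((n + 1 : ℕ) : ℝ) with hp
    set r := √((n + 1 + 1 : ℕ) : ℝ) with hr
    have hpr : p ≤ r := Real.sqrt_le_sqrt (by push_cast; linarith)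
    have hp0 : 0 ≤ p := Real.sqrt_nonneg _
    have hnp : √(n : ℝ) ≤ p := Real.sqrt_le_sqrt (by push_cast; linarith)
    have hpp : p * p = (n : ℝ) + 1 := by
      rw [hp, Real.mul_self_sqrt (by positivity)]; push_cast; ring
    have h1' : |hkU (s ^ 2) n x| ≤ s ^ n * (y + p) ^ n * E := by
      refine h1.trans ?_
      gcongr
    calc |hkU (s ^ 2) (n + 1 + 1) x|
        = |-(s ^ 2 * x) * hkU (s ^ 2) (n + 1) x - s ^ 2 * ((n : ℝ) + 1) * hkU (s ^ 2) n x| := by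
          simp only [hkU]
      _ ≤ |-(s ^ 2 * x) * hkU (s ^ 2) (n + 1) x| + |s ^ 2 * ((n : ℝ) + 1) * hkU (s ^ 2) n x| :=
          abs_sub _ _
      _ = s * y * |hkU (s ^ 2) (n + 1) x| + s ^ 2 * (p * p) * |hkU (s ^ 2) n x| := by
          rw [abs_mul, abs_mul, abs_neg, abs_mul, hpp,
            abs_of_nonneg (by positivity : 0 ≤ s ^ 2 * ((n : ℝ) + 1)),
            abs_of_nonneg (by positivity : 0 ≤ s ^ 2), hy]
          ring
      _ ≤ s * y * (s ^ (n + 1) * (y + p) ^ (n + 1) * E)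
            + s ^ 2 * (p * p) * (s ^ n * (y + p) ^ n * E) := by
          gcongr
      _ = s ^ (n + 2) * ((y + p) ^ n * (y * (y + p) + p * p)) * E := by ring
      _ ≤ s ^ (n + 2) * ((y + p) ^ n * ((y + p) * (y + p))) * E := by
          gcongr
          nlinarith [mul_nonneg hy0 hp0]
      _ = s ^ (n + 2) * (y + p) ^ (n + 2) * E := by ring
      _ ≤ s ^ (n + 1 + 1) * (y + r) ^ (n + 1 + 1) * E := by
          gcongr

lemma hkU_bound (s : ℝ) (hs : 0 ≤ s) (x : ℝ) (n : ℕ) :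
    |hkU (s ^ 2) n x| ≤ (s * Real.exp 1 * √n) ^ n * Real.exp (-(s ^ 2 * x ^ 2 / 4)) := by
  refine (hkU_bound_aux s hs x n).1.trans ?_
  set y := s * |x| with hy
  have hy0 : 0 ≤ y := by positivity
  have hyy : s ^ 2 * x ^ 2 = y ^ 2 := by rw [hy, mul_pow, sq_abs]
  rw [hyy]
  rcases Nat.eq_zero_or_pos n with rfl | hn
  · simp; nlinarith [sq_nonneg y]
  have hr : 0 < √(n : ℝ) := Real.sqrt_pos.2 (by exact_mod_cast hn)
  set r := √(n : ℝ) with hrd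
  have hrr : (n : ℝ) = r * r := by rw [hrd, Real.mul_self_sqrt (by positivity)]
  have key : (y + r) ^ n ≤ r ^ n * Real.exp (y * r) := by
    have : y + r ≤ r * Real.exp (y / r) := by
      calc y + r = r * (y / r + 1) := by field_simp
        _ ≤ _ := by gcongr; exact Real.add_one_le_exp _
    calc (y + r) ^ n ≤ (r * Real.exp (y / r)) ^ n := by gcongr
      _ = r ^ n * Real.exp (y * r) := by
        rw [mul_pow, ← Real.exp_nat_mul, hrr]
        congr 2
        field_simp
  calc s ^ n * (y + r) ^ n * Real.exp (-(y ^ 2 / 2))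
      ≤ s ^ n * (r ^ n * Real.exp (y * r)) * Real.exp (-(y ^ 2 / 2)) := by gcongr
    _ = s ^ n * r ^ n * Real.exp (y * r - y ^ 2 / 2) := by
        rw [sub_eq_add_neg, Real.exp_add]; ring
    _ ≤ s ^ n * r ^ n * Real.exp (n * 1 + -(y ^ 2 / 4)) := by
        gcongr
        nlinarith [sq_nonneg (y / 2 - r)]
    _ = _ := by
        rw [Real.exp_add, Real.exp_nat_mul]; ring

lemma hk_pd {d : ℕ} (a c : ℝ) (γ : Fin d → ℕ) (i : Fin d) :
    pd i (fun x : Euc d => c * ∏ j, hkU a (γ j) (x j)) =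
      fun x : Euc d => c * ∏ j, hkU a (Function.update γ i (γ i + 1) j) (x j) := by
  funext x
  have h1 : ∀ j ∈ (Finset.univ : Finset (Fin d)), HasFDerivAt (fun x : Euc d => hkU a (γ j) (x j))
      (hkU a (γ j + 1) (x j) • (EuclideanSpace.proj j : Euc d →L[ℝ] ℝ)) x := by
    intro j _
    exact ((hkU_hasDerivAt a (γ j)).1 (x j)).comp_hasFDerivAt x
      (EuclideanSpace.proj j : Euc d →L[ℝ] ℝ).hasFDerivAt
  have h2 := (HasFDerivAt.finsetProd h1).const_mul c
  unfold pd
  rw [h2.fderiv]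
  simp only [ContinuousLinearMap.smul_apply, ContinuousLinearMap.sum_apply, smul_eq_mul]
  congr 1
  rw [Finset.sum_eq_single i]
  · rw [← Finset.mul_prod_erase Finset.univ _ (Finset.mem_univ i)]
    have e1 : (EuclideanSpace.proj i : Euc d →L[ℝ] ℝ) (EuclideanSpace.single i 1) = 1 := by
      simp
    rw [e1, Function.update_self, mul_one, mul_comm]
    congr 1
    refine Finset.prod_congr rfl fun j hj => ?_
    rw [Function.update_of_ne (Finset.ne_of_mem_erase hj)]
  · intro j _ hj
    simp [hj]
  · simp

lemma hk_pd_iter {d : ℕ} (a c : ℝ) (i : Fin d) (k : ℕ) (γ : Fin d → ℕ) :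
    (pd i)^[k] (fun x : Euc d => c * ∏ j, hkU a (γ j) (x j)) =
      fun x : Euc d => c * ∏ j, hkU a (Function.update γ i (γ i + k) j) (x j) := by
  induction k generalizing γ with
  | zero => simp
  | succ k ih =>
    rw [Function.iterate_succ_apply, hk_pd, ih]
    simp only [Function.update_self, Function.update_idem]
    rw [show γ i + 1 + k = γ i + (k + 1) by ring]

lemma hk_foldr {d : ℕ} (a c : ℝ) (β : Fin d → ℕ) (l : List (Fin d)) (hl : l.Nodup) :
    l.foldr (fun i g => (pd i)^[β i] g) (fun x : Euc d => c * ∏ j, hkU a 0 (x j)) =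
      fun x : Euc d => c * ∏ j, hkU a (if j ∈ l then β j else 0) (x j) := by
  induction l with
  | nil => simp
  | cons i l ih =>
    rw [List.nodup_cons] at hl
    rw [List.foldr_cons, ih hl.2, hk_pd_iter a c i (β i) (fun j => if j ∈ l then β j else 0)]
    funext x
    congr 1
    refine Finset.prod_congr rfl fun j _ => ?_
    by_cases h : j = i
    · subst h; simp [hl.1]
    · simp [h]

lemma hk_mderiv {d : ℕ} (t : ℝ) (β : Fin d → ℕ) :
    mderiv β (heatKernel d t) = fun x : Euc d =>
      (4 * Real.pi * t) ^ (-(d : ℝ) / 2) * ∏ j, hkU (1 / (2 * t)) (β j) (x j) := by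
  have h := hk_foldr (1 / (2 * t)) ((4 * Real.pi * t) ^ (-(d : ℝ) / 2)) β (List.finRange d)
    (List.nodup_finRange d)
  simp only [List.mem_finRange, if_true] at h
  rw [← h]
  unfold mderiv
  congr 1
  funext x
  unfold heatKernel
  congr 1
  simp only [hkU]
  rw [← Real.exp_sum, EuclideanSpace.norm_sq_eq]
  congr 1
  rw [neg_div, Finset.sum_neg_distrib, Finset.sum_div]
  congr 1
  refine Finset.sum_congr rfl fun j _ => ?_
  rw [Real.norm_eq_abs, sq_abs]
  by_cases ht : t = 0
  · simp [ht]
  field_simp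
  norm_num

lemma hk_pointwise {d : ℕ} (t : ℝ) (ht : 0 < t) (β : Fin d → ℕ) (x : Euc d) :
    ‖mderiv β (heatKernel d t) x‖ ≤
      ((4 * Real.pi * t) ^ (-(d : ℝ) / 2) *
        (√(1 / (2 * t)) * Real.exp 1 * √(msize β : ℝ)) ^ (msize β)) *
        Real.exp (-(1 / (8 * t)) * ‖x‖ ^ 2) := by
  rw [hk_mderiv]
  set s := √(1 / (2 * t)) with hs
  have hs0 : 0 ≤ s := Real.sqrt_nonneg _
  have hss : 1 / (2 * t) = s ^ 2 := by rw [hs, Real.sq_sqrt (by positivity)]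
  rw [hss]
  simp only [norm_mul, norm_prod, Real.norm_eq_abs]
  rw [abs_of_nonneg (by positivity : 0 ≤ (4 * Real.pi * t) ^ (-(d : ℝ) / 2)),
    mul_assoc ((4 * Real.pi * t) ^ (-(d : ℝ) / 2))]
  refine mul_le_mul_of_nonneg_left ?_ (by positivity)
  calc ∏ j, |hkU (s ^ 2) (β j) (x j)|
      ≤ ∏ j, ((s * Real.exp 1 * √(msize β : ℝ)) ^ (β j) * Real.exp (-(s ^ 2 * (x j) ^ 2 / 4))) := by
        refine Finset.prod_le_prod (fun j _ => abs_nonneg _) fun j _ => ?_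
        refine (hkU_bound s hs0 (x j) (β j)).trans ?_
        have : β j ≤ msize β := Finset.single_le_sum (f := β) (fun _ _ => Nat.zero_le _)
          (Finset.mem_univ j)
        gcongr
    _ = _ := by
        rw [Finset.prod_mul_distrib, Finset.prod_pow_eq_pow_sum, ← Real.exp_sum]
        unfold msize
        congr 2
        rw [EuclideanSpace.norm_sq_eq, Finset.mul_sum]
        refine Finset.sum_congr rfl fun j _ => ?_
        rw [Real.norm_eq_abs, sq_abs, ← hss]
        field_simp
        ring

lemma hk_Lq {d : ℕ} (b : ℝ) (hb : 0 < b) (q : ℝ≥0∞) (hq : 1 ≤ q) :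
    eLpNorm (fun x : Euc d => Real.exp (-b * ‖x‖ ^ 2)) q volume ≤
      ENNReal.ofReal (((Real.pi / b) ^ ((d : ℝ) / 2)) ^ (q⁻¹.toReal)) := by
  have hle : ∀ x : Euc d, Real.exp (-b * ‖x‖ ^ 2) ≤ 1 := fun x =>
    Real.exp_le_one_iff.2 (by nlinarith [sq_nonneg ‖x‖])
  have hint : ∫ x : Euc d, Real.exp (-b * ‖x‖ ^ 2) = (Real.pi / b) ^ ((d : ℝ) / 2) := by
    rw [GaussianFourier.integral_rexp_neg_mul_sq_norm hb]
    simp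
  have hpos : 0 < (Real.pi / b) ^ ((d : ℝ) / 2) := by positivity
  have hI : Integrable (fun x : Euc d => Real.exp (-b * ‖x‖ ^ 2)) := by
    by_contra h
    rw [integral_undef h] at hint
    exact hpos.ne hint
  by_cases hqt : q = ⊤
  · subst hqt
    simp only [ENNReal.inv_top, ENNReal.toReal_zero, Real.rpow_zero]
    rw [eLpNorm_exponent_top]
    refine eLpNormEssSup_le_of_ae_bound (Filter.Eventually.of_forall fun x => ?_)
    rw [Real.norm_eq_abs, abs_of_pos (Real.exp_pos _)]
    exact hle x
  · have hq0 : q ≠ 0 := (zero_lt_one.trans_le hq).ne'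
    have hq1 : 1 ≤ q.toReal := by
      rw [← ENNReal.toReal_one]; exact ENNReal.toReal_mono hqt hq
    rw [eLpNorm_eq_lintegral_rpow_enorm_toReal hq0 hqt, ENNReal.toReal_inv, ← one_div,
      ← ENNReal.ofReal_rpow_of_pos hpos]
    refine ENNReal.rpow_le_rpow ?_ (by positivity)
    rw [← hint, ofReal_integral_eq_lintegral_ofReal hI
      (Filter.Eventually.of_forall fun x => (Real.exp_pos _).le)]
    refine lintegral_mono fun x => ?_
    rw [Real.enorm_eq_ofReal (Real.exp_pos _).le, ENNReal.ofReal_rpow_of_pos (Real.exp_pos _)]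
    refine ENNReal.ofReal_le_ofReal ?_
    exact Real.rpow_le_self_of_le_one (Real.exp_pos _).le (hle x) hq1

lemma hk_const (d N : ℕ) (hN : 1 ≤ N) (t : ℝ) (ht : 0 < t) (θ : ℝ) (h0 : 0 ≤ θ) (h1 : θ ≤ 1) :
    ((4 * Real.pi * t) ^ (-(d : ℝ) / 2) * (√(1 / (2 * t)) * Real.exp 1 * √(N : ℝ)) ^ N) *
      ((Real.pi / (1 / (8 * t))) ^ ((d : ℝ) / 2)) ^ θ ≤
    (Real.exp 1 ^ 2 * 2 ^ d) ^ ((N : ℝ) / 2) *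
      ((N : ℝ) / 2) ^ ((N : ℝ) / 2 + ((d : ℝ) / 2) * (1 - θ)) *
      t ^ (-((N : ℝ) / 2) - ((d : ℝ) / 2) * (1 - θ)) := by
  have hN' : (1 : ℝ) ≤ N := by exact_mod_cast hN
  have hNp : (0 : ℝ) < (N : ℝ) / 2 := by positivity
  set D : ℝ := (d : ℝ) / 2 with hD
  have hD0 : 0 ≤ D := by positivity
  have hpi : 0 < 4 * Real.pi := by positivity
  have e1 : (√(1 / (2 * t)) * Real.exp 1 * √(N : ℝ)) ^ N =
      (Real.exp 1 ^ 2) ^ ((N : ℝ) / 2) * ((N : ℝ) / 2) ^ ((N : ℝ) / 2) * t ^ (-((N : ℝ) / 2)) := by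
    have hb : √(1 / (2 * t)) * Real.exp 1 * √(N : ℝ) =
        √(Real.exp 1 ^ 2 * ((N : ℝ) / 2) * t⁻¹) := by
      rw [show Real.exp 1 ^ 2 * ((N : ℝ) / 2) * t⁻¹ = (1 / (2 * t)) * Real.exp 1 ^ 2 * N by
        field_simp]
      rw [Real.sqrt_mul (by positivity), Real.sqrt_mul (by positivity),
        Real.sqrt_sq (Real.exp_pos _).le]
    rw [hb, Real.sqrt_eq_rpow, ← Real.rpow_natCast, ← Real.rpow_mul (by positivity),
      show 1 / 2 * (N : ℝ) = (N : ℝ) / 2 by ring, Real.mul_rpow (by positivity) (by positivity),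
      Real.mul_rpow (by positivity) (by positivity), Real.inv_rpow ht.le, Real.rpow_neg ht.le]
  have e2 : (4 * Real.pi * t) ^ (-(d : ℝ) / 2) * ((Real.pi / (1 / (8 * t))) ^ D) ^ θ =
      (2 ^ (D * θ) * ((4 * Real.pi)⁻¹) ^ (D * (1 - θ))) * t ^ (-(D * (1 - θ))) := by
    rw [show Real.pi / (1 / (8 * t)) = 2 * (4 * Real.pi) * t by field_simp; norm_num,
      ← Real.rpow_mul (by positivity), show -(d : ℝ) / 2 = -D by rw [hD]; ring,
      Real.mul_rpow (by positivity) ht.le, Real.mul_rpow (by positivity) ht.le,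
      Real.mul_rpow (by positivity) hpi.le, Real.inv_rpow hpi.le, ← Real.rpow_neg hpi.le,
      show -(D * (1 - θ)) = -D + D * θ by ring, Real.rpow_add ht, Real.rpow_add hpi]
    ring
  have e3 : (2 : ℝ) ^ (D * θ) ≤ ((2 : ℝ) ^ d) ^ ((N : ℝ) / 2) := by
    rw [← Real.rpow_natCast, ← Real.rpow_mul (by norm_num)]
    refine Real.rpow_le_rpow_of_exponent_le (by norm_num) ?_
    have : (d : ℝ) * ((N : ℝ) / 2) = D * N := by rw [hD]; ring
    rw [this]
    gcongr
    linarith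
  have e4 : ((4 * Real.pi)⁻¹) ^ (D * (1 - θ)) ≤ ((N : ℝ) / 2) ^ (D * (1 - θ)) := by
    refine Real.rpow_le_rpow (by positivity) ?_ (mul_nonneg hD0 (by linarith))
    have : (4 * Real.pi)⁻¹ ≤ 2⁻¹ := by
      apply inv_anti₀ (by norm_num)
      linarith [Real.pi_gt_three]
    linarith
  calc _ = (Real.exp 1 ^ 2) ^ ((N : ℝ) / 2) * ((N : ℝ) / 2) ^ ((N : ℝ) / 2) * t ^ (-((N : ℝ) / 2))
        * ((4 * Real.pi * t) ^ (-(d : ℝ) / 2) * ((Real.pi / (1 / (8 * t))) ^ D) ^ θ) := by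
          rw [e1]; ring
    _ = (Real.exp 1 ^ 2) ^ ((N : ℝ) / 2) * ((N : ℝ) / 2) ^ ((N : ℝ) / 2) * t ^ (-((N : ℝ) / 2))
        * ((2 ^ (D * θ) * ((4 * Real.pi)⁻¹) ^ (D * (1 - θ))) * t ^ (-(D * (1 - θ)))) := by rw [e2]
    _ ≤ (Real.exp 1 ^ 2) ^ ((N : ℝ) / 2) * ((N : ℝ) / 2) ^ ((N : ℝ) / 2) * t ^ (-((N : ℝ) / 2))
        * ((((2 : ℝ) ^ d) ^ ((N : ℝ) / 2) * ((N : ℝ) / 2) ^ (D * (1 - θ)))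
          * t ^ (-(D * (1 - θ)))) := by
        gcongr
    _ = _ := by
        rw [Real.mul_rpow (by positivity) (by positivity), Real.rpow_add hNp,
          sub_eq_add_neg (-((N : ℝ) / 2)), Real.rpow_add ht]
        ring

/-- decay of spatial derivatives of the heat kernel in `L^q`. -/
theorem heatKernel_spatial_deriv_Lq_bound (d : ℕ) (hd : 1 ≤ d) :
    ∃ C₀ : ℝ, 0 < C₀ ∧
      ∀ (β : Fin d → ℕ), β ≠ 0 → ∀ (q : ℝ≥0∞), 1 ≤ q → ∀ t : ℝ, 0 < t →
        eLpNorm (mderiv β (heatKernel d t)) q volume ≤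
          ENNReal.ofReal
            (C₀ ^ ((msize β : ℝ) / 2) *
              ((msize β : ℝ) / 2) ^
                ((msize β : ℝ) / 2 + ((d : ℝ) / 2) * (1 - q⁻¹.toReal)) *
              t ^ (-((msize β : ℝ) / 2) - ((d : ℝ) / 2) * (1 - q⁻¹.toReal))) := by
  refine ⟨Real.exp 1 ^ 2 * 2 ^ d, by positivity, ?_⟩
  intro β hβ q hq t ht
  have hN : 1 ≤ msize β := by
    rw [Nat.one_le_iff_ne_zero]
    intro h
    apply hβ
    funext i
    exact (Finset.sum_eq_zero_iff.1 h) i (Finset.mem_univ i)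
  have hθ1 : q⁻¹.toReal ≤ 1 := by
    rw [← ENNReal.toReal_one]
    exact ENNReal.toReal_mono ENNReal.one_ne_top (ENNReal.inv_le_one.2 hq)
  refine (eLpNorm_mono_real (hk_pointwise t ht β)).trans ?_
  set M : ℝ := (4 * Real.pi * t) ^ (-(d : ℝ) / 2) *
        (√(1 / (2 * t)) * Real.exp 1 * √(msize β : ℝ)) ^ (msize β) with hM
  have hM0 : 0 ≤ M := by positivity
  have e : (fun x : Euc d => M * Real.exp (-(1 / (8 * t)) * ‖x‖ ^ 2)) =
      M • (fun x : Euc d => Real.exp (-(1 / (8 * t)) * ‖x‖ ^ 2)) := rfl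
  rw [e, eLpNorm_const_smul, Real.enorm_eq_ofReal hM0]
  refine (mul_le_mul_right (hk_Lq (d := d) (1 / (8 * t)) (by positivity) q hq) _).trans ?_
  rw [← ENNReal.ofReal_mul hM0]
  exact ENNReal.ofReal_le_ofReal
    (hk_const d (msize β) hN t ht _ ENNReal.toReal_nonneg hθ1)

end
end

section
/- For every dimension d ∈ ℕ, d ≥ 1, there exists a constant C₀ > 0 such that for every nonzero multi-index β ∈ ℕ^d, every 1 ≤ q ≤ ∞ and every t > 0, the gradient of the heat kernel satisfies ‖D_x^β ∇G(·,t)‖_{L^q(ℝ^d)} ≤ C₀^{|β|/2} (|β|/2)^{(|β|+1)/2 + (d/2)(1−1/q)} t^{−(|β|+1)/2 − (d/2)(1−1/q)}. -/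
open MeasureTheory Real Filter
open scoped ENNReal BigOperators Topology

noncomputable section

/-- Real parts of the complex derivatives of the one-dimensional Gaussian. -/
noncomputable def phi (t : ℝ) (k : ℕ) (s : ℝ) : ℝ :=
  (iteratedDeriv k (fun z : ℂ => Complex.exp (-z ^ 2 / (4 * t))) (s : ℂ)).re

lemma gauss_contDiff (t : ℝ) : ContDiff ℂ (⊤ : ℕ∞) (fun z : ℂ => Complex.exp (-z ^ 2 / (4 * t))) := by
  apply ContDiff.cexp
  apply ContDiff.div_const
  fun_prop

lemma phi_hasDerivAt (t : ℝ) (k : ℕ) (s : ℝ) : HasDerivAt (phi t k) (phi t (k + 1) s) s := by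
  unfold phi
  apply HasDerivAt.real_of_complex
  rw [iteratedDeriv_succ]
  apply DifferentiableAt.hasDerivAt
  exact ((gauss_contDiff t).differentiable_iteratedDeriv k (by exact_mod_cast ENat.natCast_lt_top k)) _

lemma phi_zero (t s : ℝ) : phi t 0 s = Real.exp (-s ^ 2 / (4 * t)) := by
  unfold phi
  rw [iteratedDeriv_zero]
  rw [← Complex.exp_ofReal_re]
  push_cast
  rfl

lemma phi_bound (t : ℝ) (ht : 0 < t) (k : ℕ) (s r : ℝ) (hr : 0 < r) :
    |phi t k s| ≤ k.factorial * (Real.exp (r ^ 2 / (4 * t)) * Real.exp (-s ^ 2 / (8 * t))) / r ^ k := by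
  refine (Complex.abs_re_le_norm _).trans ?_
  refine Complex.norm_iteratedDeriv_le_of_forall_mem_sphere_norm_le k hr
    ((gauss_contDiff t).differentiable (by simp)).diffContOnCl ?_
  intro z hz
  rw [Complex.norm_exp, ← Real.exp_add, Real.exp_le_exp]
  have h1 : (-z ^ 2 / (4 * (t : ℂ))).re = -(z.re ^ 2 - z.im ^ 2) / (4 * t) := by
    have : (4 * (t : ℂ)) = ((4 * t : ℝ) : ℂ) := by push_cast; rfl
    rw [this, Complex.div_ofReal_re]
    simp [pow_two]
  have h2 : (z.re - s) ^ 2 + z.im ^ 2 = r ^ 2 := by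
    have h3 : ‖z - s‖ = r := by simpa using hz
    rw [← h3, ← Complex.normSq_eq_norm_sq, Complex.normSq_apply]
    simp [pow_two]
  rw [h1]
  have e : r ^ 2 / (4 * t) + -s ^ 2 / (8 * t) = (r ^ 2 - s ^ 2 / 2) / (4 * t) := by
    field_simp; ring
  rw [e]
  gcongr
  nlinarith [sq_nonneg (2 * z.re - s), sq_nonneg (z.re - s)]

/-- Products of one-dimensional derivatives. -/
noncomputable def Fm (d : ℕ) (t : ℝ) (γ : Fin d → ℕ) (x : Euc d) : ℝ :=
  (4 * Real.pi * t) ^ (-(d : ℝ) / 2) * ∏ i, phi t (γ i) (x i)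

lemma heat_eq (d : ℕ) (t : ℝ) : heatKernel d t = Fm d t 0 := by
  funext x
  unfold heatKernel Fm
  simp only [Pi.zero_apply, phi_zero]
  rw [← Real.exp_sum, EuclideanSpace.norm_sq_eq]
  simp [neg_div, Finset.sum_div]

lemma Fm_hasFDerivAt (d : ℕ) (t : ℝ) (γ : Fin d → ℕ) (x : Euc d) :
    ∃ L : Euc d →L[ℝ] ℝ, HasFDerivAt (Fm d t γ) L x ∧
      ∀ k, L (EuclideanSpace.single k 1) = Fm d t (γ + Pi.single k 1) x := by
  have h : ∀ i ∈ (Finset.univ : Finset (Fin d)), HasFDerivAt (fun x : Euc d => phi t (γ i) (x i))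
      (phi t (γ i + 1) (x i) • (EuclideanSpace.proj i : Euc d →L[ℝ] ℝ)) x := by
    intro i _
    exact (phi_hasDerivAt t (γ i) (x i)).comp_hasFDerivAt x
      (EuclideanSpace.proj i : Euc d →L[ℝ] ℝ).hasFDerivAt
  have h2 := (HasFDerivAt.finsetProd h).const_mul ((4 * Real.pi * t) ^ (-(d : ℝ) / 2))
  refine ⟨_, h2, ?_⟩
  intro k
  unfold Fm
  simp only [smul_apply, sum_apply, smul_eq_mul]
  congr 1
  rw [Finset.sum_eq_single k]
  · rw [← Finset.mul_prod_erase Finset.univ _ (Finset.mem_univ k), mul_comm]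
    congr 1
    · simp
    · refine Finset.prod_congr rfl ?_
      intro j hj
      simp [Finset.ne_of_mem_erase hj]
  · intro b _ hb
    simp [hb]
  · simp

/-- The vector field with components `Fm (γ + e_j)`. -/
noncomputable def Vm (d : ℕ) (t : ℝ) (γ : Fin d → ℕ) (x : Euc d) : Euc d :=
  WithLp.toLp 2 (fun j => Fm d t (γ + Pi.single j 1) x)

lemma gradHeat_eq (d : ℕ) (t : ℝ) : gradHeat d t = Vm d t 0 := by
  funext x
  unfold gradHeat Vm
  change gradient (heatKernel d t) x = _
  rw [heat_eq]
  obtain ⟨L, hL, hk⟩ := Fm_hasFDerivAt d t 0 x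
  rw [hL.hasGradientAt.gradient]
  ext j
  have : inner ℝ ((InnerProductSpace.toDual ℝ (Euc d)).symm L) (EuclideanSpace.single j (1:ℝ))
      = L (EuclideanSpace.single j 1) := by
    rw [InnerProductSpace.toDual_symm_apply]
  rw [hk] at this
  change _ = Fm d t (0 + Pi.single j 1) x
  rw [← this, EuclideanSpace.inner_single_right]
  simp

lemma pd_Vm (d : ℕ) (t : ℝ) (γ : Fin d → ℕ) (k : Fin d) :
    pd k (Vm d t γ) = Vm d t (γ + Pi.single k 1) := by
  funext x
  unfold pd
  choose L hL hk using fun j => Fm_hasFDerivAt d t (γ + Pi.single j 1) x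
  have h1 : HasFDerivAt (fun x => (fun j => Fm d t (γ + Pi.single j 1) x))
      (ContinuousLinearMap.pi L) x := hasFDerivAt_pi.2 hL
  have h2 : HasFDerivAt (Vm d t γ) _ x :=
    ((PiLp.continuousLinearEquiv 2 ℝ (fun _ : Fin d => ℝ)).symm.toContinuousLinearMap.hasFDerivAt).comp x h1
  rw [h2.fderiv]
  ext j
  change L j (EuclideanSpace.single k 1) = Fm d t _ x
  rw [hk, add_right_comm]

lemma pd_iter_Vm (d : ℕ) (t : ℝ) (k : Fin d) (m : ℕ) (γ : Fin d → ℕ) :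
    (pd k)^[m] (Vm d t γ) = Vm d t (γ + Pi.single k m) := by
  induction m with
  | zero => simp
  | succ m ih =>
    rw [Function.iterate_succ_apply', ih, pd_Vm, add_assoc, ← Pi.single_add]

lemma foldr_Vm (d : ℕ) (t : ℝ) (β : Fin d → ℕ) (l : List (Fin d)) :
    l.foldr (fun i g => (pd i)^[β i] g) (Vm d t 0)
      = Vm d t (l.map (fun i => Pi.single i (β i))).sum := by
  induction l with
  | nil => simp
  | cons a l ih =>
    rw [List.foldr_cons, ih, pd_iter_Vm, List.map_cons, List.sum_cons, add_comm]

lemma mderiv_eq (d : ℕ) (t : ℝ) (β : Fin d → ℕ) : mderiv β (gradHeat d t) = Vm d t β := by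
  unfold mderiv
  rw [gradHeat_eq, foldr_Vm, ← List.ofFn_eq_map, List.sum_ofFn, Finset.univ_sum_single]

lemma Fm_bound (d : ℕ) (t : ℝ) (ht : 0 < t) (γ : Fin d → ℕ) (r : ℝ) (hr : 0 < r) (x : Euc d) :
    |Fm d t γ x| ≤ (4 * Real.pi * t) ^ (-(d : ℝ) / 2) * (((∑ i, γ i).factorial *
      Real.exp (r ^ 2 / (4 * t)) ^ d / r ^ (∑ i, γ i)) * Real.exp (-‖x‖ ^ 2 / (8 * t))) := by
  unfold Fm
  rw [abs_mul, abs_of_nonneg (by positivity), Finset.abs_prod]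
  gcongr
  refine (Finset.prod_le_prod (fun _ _ => abs_nonneg _)
    (fun i _ => phi_bound t ht (γ i) (x i) r hr)).trans ?_
  rw [Finset.prod_div_distrib, Finset.prod_mul_distrib, Finset.prod_mul_distrib,
    ← Real.exp_sum Finset.univ (fun i => -x i ^ 2 / (8 * t)), Finset.prod_pow_eq_pow_sum, EuclideanSpace.norm_sq_eq]
  have e : ∑ i, -x i ^ 2 / (8 * t) = -(∑ i, ‖x i‖ ^ 2) / (8 * t) := by
    simp [neg_div, Finset.sum_div]
  rw [e]
  have h : ((∏ i, ((γ i).factorial : ℝ))) ≤ (∑ i, γ i).factorial := by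
    have := Nat.le_of_dvd (Nat.factorial_pos _) (Nat.prod_factorial_dvd_factorial_sum Finset.univ γ)
    exact_mod_cast this
  simp only [Finset.prod_const, Finset.card_univ, Fintype.card_fin]
  rw [mul_div_right_comm, ← mul_assoc, mul_div_right_comm]
  calc _ = (∏ i, ((γ i).factorial : ℝ)) * (Real.exp (r ^ 2 / (4 * t)) ^ d / r ^ (∑ i, γ i) *
        Real.exp (-(∑ i, ‖x i‖ ^ 2) / (8 * t))) := by ring
    _ ≤ (∑ i, γ i).factorial * (Real.exp (r ^ 2 / (4 * t)) ^ d / r ^ (∑ i, γ i) *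
        Real.exp (-(∑ i, ‖x i‖ ^ 2) / (8 * t))) := by gcongr
    _ = _ := by ring

lemma Vm_bound (d : ℕ) (t : ℝ) (ht : 0 < t) (β : Fin d → ℕ) (r : ℝ) (hr : 0 < r) (x : Euc d) :
    ‖Vm d t β x‖ ≤ (d * ((4 * Real.pi * t) ^ (-(d : ℝ) / 2) * ((msize β + 1).factorial *
      Real.exp (r ^ 2 / (4 * t)) ^ d / r ^ (msize β + 1)))) * Real.exp (-‖x‖ ^ 2 / (8 * t)) := by
  have h1 : ‖Vm d t β x‖ ≤ ∑ j, |Fm d t (β + Pi.single j 1) x| := by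
    rw [EuclideanSpace.norm_eq]
    apply Real.sqrt_le_iff.2
    refine ⟨Finset.sum_nonneg fun _ _ => abs_nonneg _, ?_⟩
    exact Finset.sum_sq_le_sq_sum_of_nonneg (fun _ _ => abs_nonneg _)
  refine h1.trans ?_
  have h2 : ∀ j : Fin d, ∑ i, (β + Pi.single j 1 : Fin d → ℕ) i = msize β + 1 := by
    intro j
    simp [msize, Finset.sum_add_distrib]
  refine (Finset.sum_le_sum (fun j _ => Fm_bound d t ht (β + Pi.single j 1) r hr x)).trans ?_
  simp only [h2, Finset.sum_const, Finset.card_univ, Fintype.card_fin, nsmul_eq_mul]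
  apply le_of_eq
  ring

lemma gauss_eLpNorm (d : ℕ) (t : ℝ) (ht : 0 < t) (q : ℝ≥0∞) (hq : 1 ≤ q) :
    eLpNorm (fun x : Euc d => Real.exp (-‖x‖ ^ 2 / (8 * t))) q volume ≤
      ENNReal.ofReal ((8 * Real.pi * t) ^ ((d : ℝ) / 2 * q⁻¹.toReal)) := by
  have hle : ∀ x : Euc d, -‖x‖ ^ 2 / (8 * t) ≤ 0 := fun x => by
    rw [neg_div]; have : 0 ≤ ‖x‖ ^ 2 / (8 * t) := by positivity
    linarith
  by_cases hT : q = ⊤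
  · subst hT
    rw [eLpNorm_exponent_top]
    simp only [ENNReal.inv_top, ENNReal.toReal_zero, mul_zero, Real.rpow_zero]
    apply eLpNormEssSup_le_of_ae_bound
    refine Eventually.of_forall fun x => ?_
    rw [Real.norm_eq_abs, Real.abs_exp, Real.exp_le_one_iff]
    exact hle x
  have hq0 : q ≠ 0 := (lt_of_lt_of_le one_pos hq).ne'
  have hq1 : 1 ≤ q.toReal := by
    have := ENNReal.toReal_mono hT hq
    simpa using this
  rw [eLpNorm_eq_lintegral_rpow_enorm_toReal hq0 hT]
  have hI : ∫ x : Euc d, Real.exp (-‖x‖ ^ 2 / (8 * t)) = (8 * Real.pi * t) ^ ((d : ℝ) / 2) := by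
    have := GaussianFourier.integral_rexp_neg_mul_sq_norm (V := Euc d) (b := 1 / (8 * t)) (by positivity)
    rw [finrank_euclideanSpace_fin] at this
    convert this using 2
    · funext x; congr 1; ring
    · field_simp
  have hInt : Integrable (fun x : Euc d => Real.exp (-‖x‖ ^ 2 / (8 * t))) := by
    apply Integrable.of_integral_ne_zero
    rw [hI]; positivity
  have h1 : ∫⁻ x : Euc d, ‖Real.exp (-‖x‖ ^ 2 / (8 * t))‖ₑ ^ q.toReal ≤
      ENNReal.ofReal ((8 * Real.pi * t) ^ ((d : ℝ) / 2)) := by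
    rw [← hI, ofReal_integral_eq_lintegral_ofReal hInt (Eventually.of_forall fun x => (Real.exp_pos _).le)]
    apply lintegral_mono
    intro x
    simp only
    rw [Real.enorm_eq_ofReal (Real.exp_pos _).le]
    refine (ENNReal.rpow_le_rpow_of_exponent_ge ?_ hq1).trans (by simp)
    rw [ENNReal.ofReal_le_one, Real.exp_le_one_iff]
    exact hle x
  refine (ENNReal.rpow_le_rpow h1 (by positivity)).trans ?_
  rw [ENNReal.ofReal_rpow_of_nonneg (by positivity) (by positivity), ← Real.rpow_mul (by positivity),
    ENNReal.toReal_inv, one_div]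

lemma final_ineq (d n : ℕ) (hd : 1 ≤ d) (hn : 1 ≤ n) (t : ℝ) (ht : 0 < t) (p : ℝ) (hp0 : 0 ≤ p)
    (hp1 : p ≤ 1) :
    (d * ((4 * Real.pi * t) ^ (-(d : ℝ) / 2) * ((n + 1).factorial *
      Real.exp (√(n * t) ^ 2 / (4 * t)) ^ d / √(n * t) ^ (n + 1)))) *
      (8 * Real.pi * t) ^ ((d : ℝ) / 2 * p) ≤
    ((d * (8 * Real.pi) ^ ((d : ℝ) / 2) * (2 * Real.exp (d / 4)) * 2 ^ (((d : ℝ) + 2) / 2)) ^ 2) ^ ((n : ℝ) / 2) *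
      ((n : ℝ) / 2) ^ (((n : ℝ) + 1) / 2 + ((d : ℝ) / 2) * (1 - p)) *
        t ^ (-(((n : ℝ) + 1) / 2) - ((d : ℝ) / 2) * (1 - p)) := by
  have hd' : (1 : ℝ) ≤ d := by exact_mod_cast hd
  have hn' : (1 : ℝ) ≤ n := by exact_mod_cast hn
  have hn0 : (0 : ℝ) < n := by linarith
  have hpi := Real.pi_gt_three
  set A : ℝ := d * (8 * Real.pi) ^ ((d : ℝ) / 2) with hA
  have hA1 : 1 ≤ A := by
    have : 1 ≤ (8 * Real.pi) ^ ((d : ℝ) / 2) := Real.one_le_rpow (by linarith) (by positivity)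
    nlinarith
  set B : ℝ := 2 * Real.exp (d / 4) with hB
  -- constants
  have eK : ((A * B * 2 ^ (((d : ℝ) + 2) / 2)) ^ 2) ^ ((n : ℝ) / 2)
      = A ^ n * B ^ n * (2 ^ (((d : ℝ) + 2) / 2)) ^ n := by
    rw [← Real.rpow_natCast _ 2, ← Real.rpow_mul (by positivity)]
    rw [show ((2 : ℕ) : ℝ) * ((n : ℝ) / 2) = n by push_cast; ring, Real.rpow_natCast, mul_pow, mul_pow]
  have e1 : Real.exp (√(n * t) ^ 2 / (4 * t)) ^ d = Real.exp (d / 4) ^ n := by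
    rw [Real.sq_sqrt (by positivity), ← Real.exp_nat_mul, ← Real.exp_nat_mul]
    congr 1; field_simp
  have e2 : √(n * t) ^ (n + 1) = (n : ℝ) ^ (((n : ℝ) + 1) / 2) * t ^ (((n : ℝ) + 1) / 2) := by
    rw [← Real.mul_rpow (by positivity) (by positivity), Real.sqrt_eq_rpow, ← Real.rpow_natCast,
      ← Real.rpow_mul (by positivity)]
    congr 1; push_cast; ring
  have f1 : ((n + 1).factorial : ℝ) ≤ 2 ^ n * (n : ℝ) ^ n := by
    have h1 : n + 1 ≤ 2 ^ n := Nat.lt_two_pow_self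
    have h2 := Nat.factorial_le_pow n
    rw [Nat.factorial_succ]
    exact_mod_cast Nat.mul_le_mul h1 h2
  have g1 : (4 * Real.pi * t) ^ (-(d : ℝ) / 2) ≤ t ^ (-(d : ℝ) / 2) := by
    rw [Real.mul_rpow (by positivity) (by positivity)]
    refine mul_le_of_le_one_left (by positivity) ?_
    exact Real.rpow_le_one_of_one_le_of_nonpos (by linarith) (by linarith)
  have g2 : (8 * Real.pi * t) ^ ((d : ℝ) / 2 * p) ≤ (8 * Real.pi) ^ ((d : ℝ) / 2) * t ^ ((d : ℝ) / 2 * p) := by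
    rw [Real.mul_rpow (by positivity) (by positivity)]
    gcongr
    · linarith
    · nlinarith
  have et : t ^ (-(((n : ℝ) + 1) / 2) - ((d : ℝ) / 2) * (1 - p))
      = t ^ (-(d : ℝ) / 2) * t ^ ((d : ℝ) / 2 * p) / t ^ (((n : ℝ) + 1) / 2) := by
    rw [← Real.rpow_add ht, ← Real.rpow_sub ht]
    congr 1; ring
  have hnn : (n : ℝ) ^ n / (n : ℝ) ^ (((n : ℝ) + 1) / 2) ≤
      (2 ^ (((d : ℝ) + 2) / 2)) ^ n * ((n : ℝ) / 2) ^ (((n : ℝ) + 1) / 2 + ((d : ℝ) / 2) * (1 - p)) := by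
    rw [Real.div_rpow (by positivity) (by positivity), ← Real.rpow_natCast, ← Real.rpow_sub hn0,
      ← Real.rpow_natCast (2 ^ _) n, ← Real.rpow_mul (by positivity), mul_div_left_comm,
      ← Real.rpow_sub (by positivity)]
    have h0 : 0 ≤ (d : ℝ) / 2 * (1 - p) := mul_nonneg (by positivity) (by linarith)
    have h01 : 0 ≤ (d : ℝ) / 2 * p := mul_nonneg (by positivity) (by linarith)
    rw [← mul_one ((n : ℝ) ^ ((n : ℝ) - _))]
    gcongr
    · linarith
    · apply Real.one_le_rpow (by norm_num)
      nlinarith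
  rw [eK, e1, e2, et]
  have hAn : A ≤ A ^ n := le_self_pow₀ hA1 (by omega)
  calc _ ≤ (d * (t ^ (-(d : ℝ) / 2) * ((2 ^ n * (n : ℝ) ^ n) *
      Real.exp (d / 4) ^ n / ((n : ℝ) ^ (((n : ℝ) + 1) / 2) * t ^ (((n : ℝ) + 1) / 2))))) *
      ((8 * Real.pi) ^ ((d : ℝ) / 2) * t ^ ((d : ℝ) / 2 * p)) := by gcongr
    _ = A * B ^ n * ((n : ℝ) ^ n / (n : ℝ) ^ (((n : ℝ) + 1) / 2)) *
       (t ^ (-(d : ℝ) / 2) * t ^ ((d : ℝ) / 2 * p) / t ^ (((n : ℝ) + 1) / 2)) := by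
      rw [hA, hB, mul_pow]; field_simp
    _ ≤ A ^ n * B ^ n * ((2 ^ (((d : ℝ) + 2) / 2)) ^ n * ((n : ℝ) / 2) ^ (((n : ℝ) + 1) / 2 + ((d : ℝ) / 2) * (1 - p))) *
       (t ^ (-(d : ℝ) / 2) * t ^ ((d : ℝ) / 2 * p) / t ^ (((n : ℝ) + 1) / 2)) := by gcongr
    _ = _ := by ring

/-- decay of spatial derivatives of the gradient of the heat kernel in `L^q`. -/
theorem heatKernel_grad_spatial_deriv_Lq_bound (d : ℕ) (hd : 1 ≤ d) :
    ∃ C₀ : ℝ, 0 < C₀ ∧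
      ∀ (β : Fin d → ℕ), β ≠ 0 → ∀ (q : ℝ≥0∞), 1 ≤ q → ∀ t : ℝ, 0 < t →
        eLpNorm (mderiv β (gradHeat d t)) q volume ≤
          ENNReal.ofReal
            (C₀ ^ ((msize β : ℝ) / 2) *
              ((msize β : ℝ) / 2) ^
                (((msize β : ℝ) + 1) / 2 + ((d : ℝ) / 2) * (1 - q⁻¹.toReal)) *
              t ^ (-(((msize β : ℝ) + 1) / 2) - ((d : ℝ) / 2) * (1 - q⁻¹.toReal))) := by
  refine ⟨(d * (8 * Real.pi) ^ ((d : ℝ) / 2) * (2 * Real.exp (d / 4)) *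
    2 ^ (((d : ℝ) + 2) / 2)) ^ 2, ?_, ?_⟩
  · have : (1 : ℝ) ≤ d := by exact_mod_cast hd
    have : (0 : ℝ) < d := by linarith
    positivity
  intro β hβ q hq t ht
  have hn : 1 ≤ msize β := by
    rw [Nat.one_le_iff_ne_zero]
    intro h
    apply hβ
    funext i
    exact (Finset.sum_eq_zero_iff.1 h) i (Finset.mem_univ i)
  have hn0 : (0 : ℝ) < msize β := by exact_mod_cast hn
  have hq1 : q⁻¹.toReal ≤ 1 := by
    have := ENNReal.toReal_mono ENNReal.one_ne_top (ENNReal.inv_le_one.2 hq)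
    simpa using this
  rw [mderiv_eq]
  refine (eLpNorm_mono_real (Vm_bound d t ht β (√(msize β * t)) (by positivity))).trans ?_
  refine le_trans ?_ (ENNReal.ofReal_le_ofReal
    (final_ineq d (msize β) hd hn t ht q⁻¹.toReal ENNReal.toReal_nonneg hq1))
  rw [ENNReal.ofReal_mul (by positivity)]
  refine (eLpNorm_const_smul_le (c := (d * ((4 * Real.pi * t) ^ (-(d : ℝ) / 2) *
    ((msize β + 1).factorial * Real.exp (√(msize β * t) ^ 2 / (4 * t)) ^ d /
      √(msize β * t) ^ (msize β + 1)))))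
    (f := fun x : Euc d => Real.exp (-‖x‖ ^ 2 / (8 * t)))).trans ?_
  rw [Real.enorm_eq_ofReal (by positivity)]
  gcongr
  exact gauss_eLpNorm d t ht q hq

end
end

section
/- For every dimension d ∈ ℕ, d ≥ 1, there exists a constant C₀ > 0 such that for every nonzero multi-index β ∈ ℕ^d, every pair of exponents 1 ≤ p ≤ q ≤ ∞, every f ∈ L^p(ℝ^d) and every t > 0, ‖(D_x^β G(·,t)) ∗ f‖_{L^q(ℝ^d)} ≤ C₀^{|β|/2} (|β|/2)^{|β|/2 + (d/2)(1/p−1/q)} t^{−|β|/2 − (d/2)(1/p−1/q)} ‖f‖_{L^p(ℝ^d)}. -/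
open MeasureTheory Real Filter
open scoped ENNReal BigOperators Topology

noncomputable section

lemma itd_re (f : ℂ → ℂ) (hf : Differentiable ℂ f) (n : ℕ) :
    iteratedDeriv n (fun x : ℝ => (f x).re) = fun x : ℝ => (iteratedDeriv n f x).re := by
  induction n with
  | zero => simp
  | succ n ih =>
    rw [iteratedDeriv_succ, ih]
    funext x
    have hd : DifferentiableAt ℂ (iteratedDeriv n f) (x : ℂ) :=
      (hf.contDiff (n := (n+1 : ℕ))).differentiable_iteratedDeriv n (by exact_mod_cast Nat.lt_succ_self n) _
    have := hd.hasDerivAt.real_of_complex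
    rw [this.deriv, iteratedDeriv_succ]

lemma gauss_eq_re (t x : ℝ) : Real.exp (-x ^ 2 / (4 * t)) =
    ((fun z : ℂ => Complex.exp (-z ^ 2 / (4 * t))) (x : ℂ)).re := by
  have : Complex.exp (-(x:ℂ) ^ 2 / (4 * t)) = ((Real.exp (-x ^ 2 / (4 * t)) : ℝ) : ℂ) := by
    push_cast; rfl
  simp only [this, Complex.ofReal_re]

lemma oned (t : ℝ) (ht : 0 < t) (n : ℕ) (x : ℝ) :
    |iteratedDeriv n (fun x : ℝ => Real.exp (-x ^ 2 / (4 * t))) x| ≤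
      (n * Real.exp 1 / (2 * t)) ^ ((n : ℝ) / 2) * Real.exp (-x ^ 2 / (8 * t)) := by
  rcases Nat.eq_zero_or_pos n with rfl | hn
  · simp only [iteratedDeriv_zero, abs_exp, Nat.cast_zero, zero_div, Real.rpow_zero, one_mul]
    apply Real.exp_le_exp.2
    rw [neg_div, neg_div, neg_le_neg_iff]
    gcongr <;> norm_num
  have hn' : (0:ℝ) < n := by exact_mod_cast hn
  have hfun : (fun x : ℝ => Real.exp (-x ^ 2 / (4 * t))) =
      fun x : ℝ => ((fun z : ℂ => Complex.exp (-z ^ 2 / (4 * t))) (x : ℂ)).re := by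
    funext x; exact gauss_eq_re t x
  have hdiff : Differentiable ℂ (fun z : ℂ => Complex.exp (-z ^ 2 / (4 * t))) := by fun_prop
  rw [hfun, itd_re _ hdiff]
  refine (Complex.abs_re_le_norm _).trans ?_
  set r := Real.sqrt (2 * n * t) with hr
  have hr0 : 0 < r := Real.sqrt_pos.2 (by positivity)
  have hr2 : r ^ 2 = 2 * n * t := Real.sq_sqrt (by positivity)
  have key := Complex.norm_iteratedDeriv_le_of_forall_mem_sphere_norm_le (n := n) (c := (x:ℂ)) (R := r)
    (C := Real.exp (n / 2) * Real.exp (-x ^ 2 / (8 * t)))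
    (f := fun z : ℂ => Complex.exp (-z ^ 2 / (4 * t))) hr0 hdiff.diffContOnCl (by
      intro z hz
      rw [Complex.norm_exp, ← Real.exp_add]
      apply Real.exp_le_exp.2
      have e1 : (-z ^ 2 / (4 * (t:ℂ))).re = -(z.re ^ 2 - z.im ^ 2) / (4 * t) := by
        have : (4 * (t:ℂ)) = ((4 * t : ℝ) : ℂ) := by push_cast; rfl
        rw [this, Complex.div_ofReal_re]
        simp [pow_two]
      rw [e1]
      have hz2 : (z.re - x) ^ 2 + z.im ^ 2 = 2 * n * t := by
        rw [← hr2, ← (mem_sphere_iff_norm.1 hz), ← Complex.normSq_eq_norm_sq, Complex.normSq_apply]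
        simp; ring
      have e2 : (n : ℝ) / 2 + -x ^ 2 / (8 * t) = (4 * n * t - x ^ 2) / (8 * t) := by
        field_simp; ring
      rw [e2, div_le_div_iff₀ (by positivity) (by positivity)]
      nlinarith [sq_nonneg (2 * z.re - x), mul_pos ht ht, mul_nonneg ht.le (sq_nonneg (2 * z.re - x))])
  refine key.trans ?_
  rw [← mul_assoc, mul_div_right_comm]
  gcongr
  have hrn : r ^ n = (2 * n * t) ^ ((n:ℝ) / 2) := by
    rw [hr, Real.sqrt_eq_rpow, ← Real.rpow_natCast, ← Real.rpow_mul (by positivity)]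
    congr 1; ring
  have hfac : (n.factorial : ℝ) ≤ ((n:ℝ) ^ 2) ^ ((n:ℝ)/2) := by
    rw [← Real.rpow_natCast, ← Real.rpow_mul (by positivity)]
    have : ((2:ℕ):ℝ) * ((n:ℝ)/2) = n := by push_cast; ring
    rw [this, Real.rpow_natCast]
    exact_mod_cast Nat.factorial_le_pow n
  have hexp : Real.exp ((n:ℝ)/2) = (Real.exp 1) ^ ((n:ℝ)/2) := by
    rw [← Real.exp_mul, one_mul]
  rw [hrn, hexp, mul_div_right_comm]
  calc (n.factorial : ℝ) / (2 * n * t) ^ ((n:ℝ) / 2) * (Real.exp 1) ^ ((n:ℝ)/2) ≤ ((n:ℝ) ^ 2) ^ ((n:ℝ)/2) / (2 * n * t) ^ ((n:ℝ) / 2) * (Real.exp 1) ^ ((n:ℝ)/2) := by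
        gcongr
    _ = (n * Real.exp 1 / (2 * t)) ^ ((n : ℝ) / 2) := by
      rw [← Real.div_rpow (by positivity) (by positivity), ← Real.mul_rpow (by positivity) (by positivity)]
      congr 1; field_simp

lemma pd_prod {d : ℕ} (g : ℝ → ℝ) (hg : ∀ n : ℕ, Differentiable ℝ (iteratedDeriv n g)) (c : ℝ)
    (n : Fin d → ℕ) (i : Fin d) :
    pd i (fun x : Euc d => c * ∏ j, iteratedDeriv (n j) g (x j)) =
      fun x : Euc d => c * ∏ j, iteratedDeriv ((n + (Pi.single i 1 : Fin d → ℕ)) j) g (x j) := by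
  funext x
  unfold pd
  have h1 : ∀ j ∈ Finset.univ, HasFDerivAt (fun x : Euc d => iteratedDeriv (n j) g (x j))
      (deriv (iteratedDeriv (n j) g) (x j) • (EuclideanSpace.proj j : Euc d →L[ℝ] ℝ)) x := by
    intro j _
    have hp : HasFDerivAt (fun x : Euc d => x j) (EuclideanSpace.proj j : Euc d →L[ℝ] ℝ) x :=
      (EuclideanSpace.proj j : Euc d →L[ℝ] ℝ).hasFDerivAt
    exact ((hg (n j)) (x j)).hasDerivAt.comp_hasFDerivAt x hp
  have h2 := (HasFDerivAt.finsetProd h1).const_mul c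
  rw [h2.fderiv]
  have hps : ∀ j, (EuclideanSpace.proj j : Euc d →L[ℝ] ℝ) (EuclideanSpace.single i 1) =
      if j = i then 1 else 0 := by
    intro j
    change (EuclideanSpace.single i (1:ℝ) : Euc d) j = _
    simp [Pi.single_apply]
  simp only [smul_apply, sum_apply, smul_eq_mul, hps]
  congr 1
  rw [Finset.sum_eq_single i]
  · rw [← Finset.mul_prod_erase _ _ (Finset.mem_univ i), mul_comm]
    simp only [if_true, mul_one, Pi.add_apply, Pi.single_eq_same, iteratedDeriv_succ]
    congr 1
    apply Finset.prod_congr rfl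
    intro j hj
    simp [Pi.single_eq_of_ne (Finset.ne_of_mem_erase hj)]
  · intro j _ hj
    simp [hj]
  · simp

lemma pd_iter {d : ℕ} (g : ℝ → ℝ) (hg : ∀ n : ℕ, Differentiable ℝ (iteratedDeriv n g)) (c : ℝ)
    (n : Fin d → ℕ) (i : Fin d) (k : ℕ) :
    (pd i)^[k] (fun x : Euc d => c * ∏ j, iteratedDeriv (n j) g (x j)) =
      fun x : Euc d => c * ∏ j, iteratedDeriv ((n + (Pi.single i k : Fin d → ℕ)) j) g (x j) := by
  induction k with
  | zero => simp
  | succ k ih =>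
    rw [Function.iterate_succ_apply', ih, pd_prod g hg, add_assoc, ← Pi.single_add]

lemma mderiv_prod {d : ℕ} (g : ℝ → ℝ) (hg : ∀ n : ℕ, Differentiable ℝ (iteratedDeriv n g)) (c : ℝ)
    (β : Fin d → ℕ) :
    mderiv β (fun x : Euc d => c * ∏ j, g (x j)) =
      fun x : Euc d => c * ∏ j, iteratedDeriv (β j) g (x j) := by
  have gen : ∀ l : List (Fin d), l.foldr (fun i g => (pd i)^[β i] g)
      (fun x : Euc d => c * ∏ j, g (x j)) = fun x : Euc d =>
        c * ∏ j, iteratedDeriv ((l.map (fun i => Pi.single i (β i))).sum j) g (x j) := by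
    intro l
    induction l with
    | nil => simp
    | cons a l ih =>
      rw [List.foldr_cons, ih, pd_iter g hg, List.map_cons, List.sum_cons, add_comm]
  have := gen (List.finRange d)
  unfold mderiv
  rw [this]
  have e : ((List.finRange d).map (fun i => (Pi.single i (β i) : Fin d → ℕ))).sum = β := by
    rw [← List.ofFn_eq_map, List.sum_ofFn]
    exact Finset.univ_sum_single β
  rw [e]

lemma mderiv_heat_bound {d : ℕ} (t : ℝ) (ht : 0 < t) (β : Fin d → ℕ) (x : Euc d) :
    |mderiv β (heatKernel d t) x| ≤
      (2 ^ ((d:ℝ)/2) * ((msize β : ℝ) * Real.exp 1 / (2 * t)) ^ ((msize β : ℝ)/2)) *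
        heatKernel d (2 * t) x := by
  set g : ℝ → ℝ := fun x : ℝ => Real.exp (-x ^ 2 / (4 * t)) with hgdef
  have hg : ∀ n : ℕ, Differentiable ℝ (iteratedDeriv n g) := by
    intro n
    have : ContDiff ℝ (n+1 : ℕ) g := by fun_prop
    exact this.differentiable_iteratedDeriv n (by exact_mod_cast Nat.lt_succ_self n)
  have hsum : ∀ (s : ℝ) (x : Euc d), Real.exp (-‖x‖ ^ 2 / s) = ∏ j, Real.exp (-(x j) ^ 2 / s) := by
    intro s x
    rw [← Real.exp_sum, EuclideanSpace.real_norm_sq_eq, ← Finset.sum_div, Finset.sum_neg_distrib]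
  have e1 : heatKernel d t = fun x : Euc d => (4 * π * t) ^ (-(d:ℝ)/2) * ∏ j, g (x j) := by
    funext x; unfold heatKernel; rw [hsum]
  rw [e1, mderiv_prod g hg]
  simp only []
  rw [abs_mul, Finset.abs_prod, abs_of_pos (by positivity)]
  unfold heatKernel
  rw [hsum]
  have hp : ∏ j, |iteratedDeriv (β j) g (x j)| ≤
      ((msize β : ℝ) * Real.exp 1 / (2 * t)) ^ ((msize β : ℝ)/2) *
        ∏ j, Real.exp (-(x j)^2 / (8 * t)) := by
    have : ((msize β : ℝ) * Real.exp 1 / (2 * t)) ^ ((msize β : ℝ)/2) =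
        ∏ j, ((msize β : ℝ) * Real.exp 1 / (2 * t)) ^ ((β j : ℝ)/2) := by
      rw [← Real.rpow_sum_of_nonneg (by positivity) (by intros; positivity), ← Finset.sum_div]
      simp [msize]
    rw [this, ← Finset.prod_mul_distrib]
    apply Finset.prod_le_prod
    · intros; positivity
    intro j _
    refine (oned t ht (β j) (x j)).trans ?_
    have hj : (β j : ℝ) ≤ msize β := by
      exact_mod_cast Finset.single_le_sum (f := β) (fun _ _ => Nat.zero_le _) (Finset.mem_univ j)
    gcongr
  have e2 : (4 * π * t) ^ (-(d:ℝ)/2) = 2 ^ ((d:ℝ)/2) * (4 * π * (2 * t)) ^ (-(d:ℝ)/2) := by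
    have : 4 * π * (2 * t) = 2 * (4 * π * t) := by ring
    rw [this, Real.mul_rpow (x := 2) (by positivity) (by positivity), ← mul_assoc,
      ← Real.rpow_add (by norm_num)]
    have : (d:ℝ)/2 + -(d:ℝ)/2 = 0 := by ring
    rw [this]; simp
  have e3 : (4 * (2 * t)) = 8 * t := by ring
  rw [e2, e3]
  calc _ ≤ 2 ^ ((d:ℝ)/2) * (4 * π * (2 * t)) ^ (-(d:ℝ)/2) * _ :=
        mul_le_mul_of_nonneg_left hp (by positivity)
    _ = _ := by ring

lemma heat_lintegral {d : ℕ} (s : ℝ) (hs : 0 < s) :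
    ∫⁻ x : Euc d, ENNReal.ofReal (heatKernel d s x) = 1 := by
  have h : ∫ x : Euc d, heatKernel d s x = 1 := by
    unfold heatKernel
    rw [integral_const_mul]
    have := GaussianFourier.integral_rexp_neg_mul_sq_norm (V := Euc d) (b := 1/(4*s)) (by positivity)
    have e : ∀ x : Euc d, Real.exp (-‖x‖^2/(4*s)) = Real.exp (-(1/(4*s)) * ‖x‖^2) := by
      intro x; congr 1; ring
    simp_rw [e, this]
    rw [finrank_euclideanSpace_fin]
    have : π / (1/(4*s)) = 4 * π * s := by field_simp
    rw [this, ← Real.rpow_add (by positivity)]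
    have : -(d:ℝ)/2 + (d:ℝ)/2 = 0 := by ring
    rw [this, Real.rpow_zero]
  have hi : Integrable (heatKernel d s) := integrable_of_integral_eq_one h
  rw [← ofReal_integral_eq_lintegral_ofReal hi (ae_of_all _ fun x => by unfold heatKernel; positivity), h]
  simp

lemma jensen {d : ℕ} (k : Euc d → ℝ≥0∞) (hk : Measurable k) (hk1 : ∫⁻ x, k x = 1)
    (f : Euc d → ℝ) (p : ℝ) (hp : 1 ≤ p) (hf : AEStronglyMeasurable f volume) (x : Euc d) :
    (∫⁻ y, k (x - y) * ‖f y‖ₑ) ^ p ≤ ∫⁻ y, k (x - y) * ‖f y‖ₑ ^ p := by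
  have hkm : Measurable (fun y => k (x - y)) := hk.comp (measurable_const.sub measurable_id)
  let μ : Measure (Euc d) := volume.withDensity (fun y => k (x - y))
  have hprob : IsProbabilityMeasure μ := ⟨by
    simp only [μ]
    rw [withDensity_apply _ MeasurableSet.univ, Measure.restrict_univ,
      lintegral_sub_left_eq_self (fun y => k y) x, hk1]⟩
  have hac : μ ≪ volume := withDensity_absolutelyContinuous _ _
  have h := eLpNorm_le_eLpNorm_of_exponent_le (μ := μ) (f := f) (p := 1) (q := ENNReal.ofReal p)
    (by simpa using hp) (hf.mono_ac hac)
  rw [eLpNorm_one_eq_lintegral_enorm, eLpNorm_eq_lintegral_rpow_enorm_toReal (by simp; linarith) (by simp),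
    ENNReal.toReal_ofReal (by linarith)] at h
  have h2 := ENNReal.rpow_le_rpow h (z := p) (by linarith)
  rw [← ENNReal.rpow_mul, one_div, inv_mul_cancel₀ (by linarith), ENNReal.rpow_one] at h2
  simp only [μ] at h2
  rw [lintegral_withDensity_eq_lintegral_mul₀ hkm.aemeasurable hf.enorm,
   lintegral_withDensity_eq_lintegral_mul₀ hkm.aemeasurable (hf.enorm.pow_const p)] at h2
  exact h2

lemma young_top {d : ℕ} (k : Euc d → ℝ≥0∞) (hk : Measurable k) (hk1 : ∫⁻ x, k x = 1)
    (f : Euc d → ℝ) (x : Euc d) :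
    (∫⁻ y, k (x - y) * ‖f y‖ₑ) ≤ eLpNorm f ⊤ volume := by
  calc _ ≤ ∫⁻ y, k (x - y) * eLpNorm f ⊤ volume := by
        apply lintegral_mono_ae
        rw [eLpNorm_exponent_top]
        filter_upwards [ae_le_eLpNormEssSup (f := f) (μ := volume)] with y hy
        gcongr
    _ = _ := by
      rw [lintegral_mul_const _ (show Measurable (fun y => k (x - y)) from hk.comp (measurable_const.sub measurable_id)),
        lintegral_sub_left_eq_self (fun y => k y) x, hk1, one_mul]

lemma young {d : ℕ} (k : Euc d → ℝ≥0∞) (hk : Measurable k) (hk1 : ∫⁻ x, k x = 1)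
    (S : ℝ≥0∞) (hS : S ≠ ⊤) (hkS : ∀ x, k x ≤ S) (f : Euc d → ℝ) (p q : ℝ≥0∞) (hp : 1 ≤ p) (hpq : p ≤ q)
    (hf : MemLp f p volume) :
    eLpNorm (fun x => ∫⁻ y, k (x - y) * ‖f y‖ₑ) q volume ≤
      S ^ (p⁻¹.toReal - q⁻¹.toReal) * eLpNorm f p volume := by
  rcases eq_or_ne p ⊤ with rfl | hptop
  · obtain rfl : q = ⊤ := top_le_iff.1 hpq
    simp only [sub_self, ENNReal.rpow_zero, one_mul]
    rw [eLpNorm_exponent_top (f := fun x => ∫⁻ y, k (x - y) * ‖f y‖ₑ)]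
    exact eLpNormEssSup_le_of_ae_enorm_bound (ae_of_all _ fun x => by
      simpa using young_top k hk hk1 f x)
  lift p to NNReal using hptop
  have hp1 : (1:ℝ) ≤ p := by exact_mod_cast hp
  have hp0 : (0:ℝ) < p := by linarith
  set N := eLpNorm f p volume with hN
  have hNtop : N ≠ ⊤ := hf.2.ne
  have hNp : ∫⁻ y, ‖f y‖ₑ ^ (p:ℝ) = N ^ (p:ℝ) := by
    rw [hN, eLpNorm_eq_lintegral_rpow_enorm_toReal (by exact_mod_cast hp0.ne') (by simp),
      ENNReal.coe_toReal, ← ENNReal.rpow_mul, one_div, inv_mul_cancel₀ hp0.ne', ENNReal.rpow_one]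
  set u : Euc d → ℝ≥0∞ := fun x => ∫⁻ y, k (x - y) * ‖f y‖ₑ with hu
  have hJ : ∀ x, u x ^ (p:ℝ) ≤ ∫⁻ y, k (x - y) * ‖f y‖ₑ ^ (p:ℝ) :=
    fun x => jensen k hk hk1 f p hp1 hf.1 x
  have hinf : ∀ x, u x ≤ S ^ ((p:ℝ)⁻¹) * N := by
    intro x
    have : u x ^ (p:ℝ) ≤ S * N ^ (p:ℝ) := by
      refine (hJ x).trans ?_
      rw [← hNp, ← lintegral_const_mul' _ _ hS]
      gcongr; exact hkS _
    have h2 := ENNReal.rpow_le_rpow this (z := (p:ℝ)⁻¹) (by positivity)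
    rwa [ENNReal.mul_rpow_of_nonneg _ _ (by positivity), ← ENNReal.rpow_mul, ← ENNReal.rpow_mul,
      mul_inv_cancel₀ hp0.ne', ENNReal.rpow_one, ENNReal.rpow_one] at h2
  have hpinv : ((p:ℝ≥0∞)⁻¹).toReal = (p:ℝ)⁻¹ := by simp
  rcases eq_or_ne q ⊤ with rfl | hqtop
  · rw [eLpNorm_exponent_top (f := u), hpinv]
    simp only [ENNReal.inv_top, ENNReal.toReal_zero, sub_zero]
    exact eLpNormEssSup_le_of_ae_enorm_bound (ae_of_all _ fun x => by simpa using hinf x)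
  lift q to NNReal using hqtop
  have hpq' : (p:ℝ) ≤ q := by exact_mod_cast hpq
  have hq0 : (0:ℝ) < q := by linarith
  have hqinv : ((q:ℝ≥0∞)⁻¹).toReal = (q:ℝ)⁻¹ := by simp
  have hton : ∫⁻ x, ∫⁻ y, k (x - y) * ‖f y‖ₑ ^ (p:ℝ) = N ^ (p:ℝ) := by
    rw [lintegral_lintegral_swap]
    · rw [← hNp]
      congr 1; funext y
      rw [lintegral_mul_const _ (show Measurable (fun x => k (x - y)) from hk.comp (measurable_id.sub measurable_const)),
        lintegral_sub_right_eq_self (fun y => k y) y, hk1, one_mul]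
    · apply AEMeasurable.mul
      · exact (hk.comp (measurable_fst.sub measurable_snd)).aemeasurable
      · exact (hf.1.enorm.pow_const _).comp_snd
  rw [eLpNorm_eq_lintegral_rpow_enorm_toReal (by exact_mod_cast hq0.ne') (by simp),
    ENNReal.coe_toReal, hpinv, hqinv]
  have hM : (S ^ ((p:ℝ)⁻¹) * N) ^ ((q:ℝ) - p) ≠ ⊤ :=
    ENNReal.rpow_ne_top_of_nonneg (by linarith)
      (ENNReal.mul_ne_top (ENNReal.rpow_ne_top_of_nonneg (by positivity) hS) hNtop)
  have hmain : ∫⁻ x, ‖u x‖ₑ ^ (q:ℝ) ≤ (S ^ ((p:ℝ)⁻¹) * N) ^ ((q:ℝ) - p) * N ^ (p:ℝ) := by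
    rw [← hton, ← lintegral_const_mul' _ _ hM]
    apply lintegral_mono
    intro x
    simp only [enorm_eq_self]
    calc u x ^ (q:ℝ) = u x ^ ((q:ℝ) - p) * u x ^ (p:ℝ) := by
          rw [← ENNReal.rpow_add_of_nonneg _ _ (by linarith) hp0.le]; congr 1; ring
      _ ≤ _ := mul_le_mul' (ENNReal.rpow_le_rpow (hinf x) (by linarith)) (hJ x)
  refine (ENNReal.rpow_le_rpow hmain (by positivity)).trans (le_of_eq ?_)
  rw [ENNReal.mul_rpow_of_nonneg _ N (by linarith), mul_assoc,
    ← ENNReal.rpow_add_of_nonneg _ _ (by linarith) hp0.le,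
    ENNReal.mul_rpow_of_nonneg _ _ (by positivity), ← ENNReal.rpow_mul, ← ENNReal.rpow_mul,
    ← ENNReal.rpow_mul]
  have a1 : (p:ℝ)⁻¹ * (((q:ℝ) - p) * (1 / q)) = (p:ℝ)⁻¹ - (q:ℝ)⁻¹ := by field_simp
  have a2 : ((q:ℝ) - p + p) * (1 / q) = 1 := by field_simp; ring
  rw [a1, a2, ENNReal.rpow_one]

/-- `L^p → L^q` smoothing of spatial derivatives of the heat semigroup. -/
theorem heatKernel_spatial_deriv_conv_Lp_Lq_bound (d : ℕ) (hd : 1 ≤ d) :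
    ∃ C₀ : ℝ, 0 < C₀ ∧
      ∀ (β : Fin d → ℕ), β ≠ 0 → ∀ (p q : ℝ≥0∞), 1 ≤ p → p ≤ q →
        ∀ f : Euc d → ℝ, MemLp f p volume → ∀ t : ℝ, 0 < t →
          eLpNorm (conv (mderiv β (heatKernel d t)) f) q volume ≤
            ENNReal.ofReal
              (C₀ ^ ((msize β : ℝ) / 2) *
                ((msize β : ℝ) / 2) ^
                  ((msize β : ℝ) / 2 + ((d : ℝ) / 2) * (p⁻¹.toReal - q⁻¹.toReal)) *
                t ^ (-((msize β : ℝ) / 2) - ((d : ℝ) / 2) * (p⁻¹.toReal - q⁻¹.toReal)) *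
                (eLpNorm f p volume).toReal) := by
  refine ⟨4 ^ (d:ℝ) * Real.exp 1, by positivity, ?_⟩
  intro β hβ p q hp hpq f hf t ht
  set m : ℝ := (msize β : ℝ) with hm
  have hm1 : 1 ≤ m := by
    have : 1 ≤ msize β := by
      by_contra h
      apply hβ
      have h0 : ∑ i, β i = 0 := by unfold msize at h; omega
      funext i
      exact (Finset.sum_eq_zero_iff.1 h0) i (Finset.mem_univ i)
    rw [hm]; exact_mod_cast this
  set a : ℝ := p⁻¹.toReal - q⁻¹.toReal with ha
  have hpi : p⁻¹ ≤ 1 := ENNReal.inv_le_one.2 hp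
  have ha0 : 0 ≤ a := sub_nonneg.2 (ENNReal.toReal_mono (ne_top_of_le_ne_top ENNReal.one_ne_top hpi)
    (ENNReal.inv_le_inv.2 hpq))
  have ha1 : a ≤ 1 := by
    have h1 : p⁻¹.toReal ≤ 1 := by simpa using ENNReal.toReal_mono ENNReal.one_ne_top hpi
    have h2 : 0 ≤ q⁻¹.toReal := ENNReal.toReal_nonneg
    linarith
  set A : ℝ := 2 ^ ((d:ℝ)/2) * (m * Real.exp 1 / (2 * t)) ^ (m/2) with hA
  have hA0 : 0 ≤ A := by positivity
  set k : Euc d → ℝ≥0∞ := fun x => ENNReal.ofReal (heatKernel d (2 * t) x) with hk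
  have hkm : Measurable k := by
    apply ENNReal.measurable_ofReal.comp
    unfold heatKernel
    fun_prop
  have hk1 : ∫⁻ x, k x = 1 := heat_lintegral (2 * t) (by positivity)
  have hkS : ∀ x, k x ≤ ENNReal.ofReal (t ^ (-(d:ℝ)/2)) := by
    intro x
    apply ENNReal.ofReal_le_ofReal
    unfold heatKernel
    have h1 : Real.exp (-‖x‖^2/(4 * (2 * t))) ≤ 1 := by
      apply Real.exp_le_one_iff.2
      rw [neg_div]
      exact neg_nonpos.2 (by positivity)
    have h2 : (4 * π * (2 * t)) ^ (-(d:ℝ)/2) ≤ t ^ (-(d:ℝ)/2) := by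
      apply Real.rpow_le_rpow_of_nonpos ht
      · nlinarith [Real.pi_gt_three]
      · rw [neg_div]; exact neg_nonpos.2 (by positivity)
    calc _ ≤ t ^ (-(d:ℝ)/2) * 1 := by gcongr
      _ = _ := mul_one _
  have hpt : ∀ x, ‖conv (mderiv β (heatKernel d t)) f x‖ₑ ≤
      ENNReal.ofReal A * ‖∫⁻ y, k (x - y) * ‖f y‖ₑ‖ₑ := by
    intro x
    rw [enorm_eq_self, ← lintegral_const_mul' _ _ ENNReal.ofReal_ne_top]
    refine (enorm_integral_le_lintegral_enorm _).trans ?_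
    apply lintegral_mono
    intro y
    simp only [enorm_mul]
    rw [← mul_assoc, ← ENNReal.ofReal_mul hA0]
    gcongr
    rw [Real.enorm_eq_ofReal_abs]
    exact ENNReal.ofReal_le_ofReal (mderiv_heat_bound t ht β _)
  have hY := young k hkm hk1 _ ENNReal.ofReal_ne_top hkS f p q hp hpq hf
  have h1 : eLpNorm (conv (mderiv β (heatKernel d t)) f) q volume ≤
      ENNReal.ofReal A * eLpNorm (fun x => ∫⁻ y, k (x - y) * ‖f y‖ₑ) q volume := by
    have := eLpNorm_le_nnreal_smul_eLpNorm_of_ae_le_mul' (f := conv (mderiv β (heatKernel d t)) f)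
      (g := fun x => ∫⁻ y, k (x - y) * ‖f y‖ₑ) (c := A.toNNReal) (μ := volume) (ae_of_all _ hpt) q
    simpa [ENNReal.smul_def, ENNReal.ofReal] using this
  refine h1.trans ((mul_le_mul_right hY _).trans ?_)
  rw [ENNReal.ofReal_rpow_of_pos (by positivity), ← ENNReal.ofReal_toReal hf.2.ne, 
    ENNReal.toReal_ofReal ENNReal.toReal_nonneg, ← mul_assoc,
    ← ENNReal.ofReal_mul hA0, ← ENNReal.ofReal_mul (by positivity)]
  apply ENNReal.ofReal_le_ofReal
  apply mul_le_mul_of_nonneg_right _ ENNReal.toReal_nonneg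
  have b1 : A = 2 ^ ((d:ℝ)/2) * (m/2) ^ (m/2) * Real.exp 1 ^ (m/2) * t ^ (-(m/2)) := by
    have : m * Real.exp 1 / (2 * t) = (m/2) * Real.exp 1 * t⁻¹ := by field_simp
    rw [hA, this, Real.mul_rpow (by positivity) (by positivity),
      Real.mul_rpow (by positivity) (by positivity), Real.inv_rpow ht.le, Real.rpow_neg ht.le]
    ring
  have b2 : (t ^ (-(d:ℝ)/2)) ^ a = t ^ (-((d:ℝ)/2 * a)) := by
    rw [← Real.rpow_mul ht.le]; congr 1; ring
  rw [b1, b2, sub_eq_add_neg, Real.rpow_add ht, Real.rpow_add (by positivity),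
    Real.mul_rpow (by positivity) (by positivity)]
  have b3 : (2:ℝ) ^ ((d:ℝ)/2) ≤ (4 ^ (d:ℝ)) ^ (m/2) * (m/2) ^ ((d:ℝ)/2 * a) := by
    have c1 : (2:ℝ) ^ (d:ℝ) ≤ (4 ^ (d:ℝ)) ^ (m/2) := by
      have : (4:ℝ) = 2 ^ (2:ℝ) := by norm_num
      rw [this, ← Real.rpow_mul (by norm_num), ← Real.rpow_mul (by norm_num)]
      apply Real.rpow_le_rpow_of_exponent_le (by norm_num)
      have : (0:ℝ) ≤ d := by positivity
      nlinarith
    have hda : (d:ℝ)/2 * a ≤ (d:ℝ)/2 := mul_le_of_le_one_right (by positivity) ha1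
    have c2 : (2:ℝ) ^ (-((d:ℝ)/2)) ≤ (m/2) ^ ((d:ℝ)/2 * a) := by
      calc (2:ℝ) ^ (-((d:ℝ)/2)) ≤ 2 ^ (-((d:ℝ)/2 * a)) :=
            Real.rpow_le_rpow_of_exponent_le (by norm_num) (by linarith)
        _ = (1/2) ^ ((d:ℝ)/2 * a) := by
            rw [Real.rpow_neg (by norm_num), one_div, Real.inv_rpow (by norm_num)]
        _ ≤ _ := by gcongr
    calc (2:ℝ) ^ ((d:ℝ)/2) = 2 ^ (d:ℝ) * 2 ^ (-((d:ℝ)/2)) := by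
          rw [← Real.rpow_add (by norm_num)]; congr 1; ring
      _ ≤ _ := by gcongr
  calc _ = 2 ^ ((d:ℝ)/2) * ((m/2) ^ (m/2) * Real.exp 1 ^ (m/2) * t ^ (-(m/2)) * t ^ (-((d:ℝ)/2 * a))) := by
        ring
    _ ≤ _ := mul_le_mul_of_nonneg_right b3 (by positivity)
    _ = _ := by ring

end
end

section
/- For every dimension d ∈ ℕ, d ≥ 1, there exists a constant C₀ > 0 such that for every nonzero multi-index β ∈ ℕ^d, every pair of exponents 1 ≤ p ≤ q ≤ ∞, every f ∈ L^p(ℝ^d) and every t > 0, ‖(D_x^β ∇G(·,t)) ∗ f‖_{L^q(ℝ^d)} ≤ C₀^{|β|/2} (|β|/2)^{(|β|+1)/2 + (d/2)(1/p−1/q)} t^{−(|β|+1)/2 − (d/2)(1/p−1/q)} ‖f‖_{L^p(ℝ^d)}. -/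
open MeasureTheory Real Filter
open scoped ENNReal BigOperators Topology

noncomputable section

/-- complex one-dimensional Gaussian -/
def cg (t : ℝ) (z : ℂ) : ℂ := Complex.exp (-z ^ 2 / (4 * t))

/-- `k`-th derivative of the real one-dimensional Gaussian -/
def gk (t : ℝ) (k : ℕ) (s : ℝ) : ℝ := (iteratedDeriv k (cg t) (s : ℂ)).re

lemma cg_diff (t : ℝ) : Differentiable ℂ (cg t) := by
  unfold cg; fun_prop

lemma gk_hasDerivAt (t : ℝ) (k : ℕ) (s : ℝ) : HasDerivAt (gk t k) (gk t (k + 1) s) s := by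
  have h := (((cg_diff t).contDiff (n := ⊤)).differentiable_iteratedDeriv k
    (by exact WithTop.coe_lt_top _)) (s : ℂ)
  have := h.hasDerivAt.real_of_complex
  rw [← iteratedDeriv_succ] at this
  exact this

lemma gk_zero (t s : ℝ) : gk t 0 s = Real.exp (-s ^ 2 / (4 * t)) := by
  have : (-(s:ℂ) ^ 2 / (4 * (t:ℂ))) = ((-s ^ 2 / (4 * t) : ℝ) : ℂ) := by push_cast; rfl
  simp only [gk, iteratedDeriv_zero, cg]
  rw [this, ← Complex.ofReal_exp, Complex.ofReal_re]

lemma gk_bound (t : ℝ) (ht : 0 < t) (r : ℝ) (hr : 0 < r) (k : ℕ) (s : ℝ) :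
    |gk t k s| ≤ k.factorial * (Real.exp (r ^ 2 / (4 * t)) * Real.exp (-(1 / (8 * t)) * s ^ 2)) / r ^ k := by
  refine (Complex.abs_re_le_norm _).trans ?_
  refine Complex.norm_iteratedDeriv_le_of_forall_mem_sphere_norm_le k hr (cg_diff t).diffContOnCl ?_
  intro z hz
  rw [mem_sphere_iff_norm] at hz
  have h1 : (z.re - s) ^ 2 + z.im ^ 2 = r ^ 2 := by
    rw [← hz, ← Complex.normSq_eq_norm_sq, Complex.normSq_apply]; simp; ring
  have h2 : (-z ^ 2 / (4 * (t:ℂ))).re = -(z.re ^ 2 - z.im ^ 2) / (4 * t) := by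
    have : (-z ^ 2 / (4 * (t:ℂ))) = (-z ^ 2) / ((4 * t : ℝ) : ℂ) := by push_cast; rfl
    rw [this, Complex.div_ofReal_re]
    simp [pow_two]
  rw [cg, Complex.norm_exp, h2, ← Real.exp_add]
  apply Real.exp_le_exp.2
  have : r ^ 2 / (4 * t) + -(1 / (8 * t)) * s ^ 2 = (r ^ 2 - s ^ 2 / 2) / (4 * t) := by
    field_simp; ring
  rw [this]
  gcongr
  nlinarith [sq_nonneg (2 * z.re - s)]

/-- product of one-dimensional derivatives -/
def PG {d : ℕ} (t : ℝ) (γ : Fin d → ℕ) (x : Euc d) : ℝ := ∏ i, gk t (γ i) (x i)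

lemma PG_hasFDerivAt {d : ℕ} (t : ℝ) (γ : Fin d → ℕ) (x : Euc d) :
    HasFDerivAt (PG t γ) (∑ i, PG t (γ + Pi.single i 1) x •
      (EuclideanSpace.proj i : Euc d →L[ℝ] ℝ)) x := by
  have h : ∀ i ∈ (Finset.univ : Finset (Fin d)),
      HasFDerivAt (fun x : Euc d => gk t (γ i) (x i))
        (gk t (γ i + 1) (x i) • (EuclideanSpace.proj i : Euc d →L[ℝ] ℝ)) x := by
    intro i _
    have := (gk_hasDerivAt t (γ i) (x i)).comp_hasFDerivAt x
      (EuclideanSpace.proj i : Euc d →L[ℝ] ℝ).hasFDerivAt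
    exact this
  have h2 := HasFDerivAt.finsetProd h
  refine h2.congr_fderiv ?_
  refine Finset.sum_congr rfl fun i _ => ?_
  rw [smul_smul]
  congr 1
  rw [PG, ← Finset.prod_erase_mul _ _ (Finset.mem_univ i)]
  congr 1
  · refine Finset.prod_congr rfl fun j hj => ?_
    simp [Pi.single_eq_of_ne (Finset.ne_of_mem_erase hj)]
  · simp

lemma PG_fderiv_single {d : ℕ} (t : ℝ) (γ : Fin d → ℕ) (x : Euc d) (i : Fin d) :
    fderiv ℝ (PG t γ) x (EuclideanSpace.single i 1) = PG t (γ + Pi.single i 1) x := by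
  rw [(PG_hasFDerivAt t γ x).fderiv]
  simp [PiLp.single_apply]

/-- gradient field -/
def VG {d : ℕ} (t : ℝ) (γ : Fin d → ℕ) (x : Euc d) : Euc d :=
  WithLp.toLp 2 (fun j => PG t (γ + Pi.single j 1) x)

lemma VG_diff {d : ℕ} (t : ℝ) (γ : Fin d → ℕ) : Differentiable ℝ (VG (d := d) t γ) := by
  rw [differentiable_euclidean]
  intro i x
  exact (PG_hasFDerivAt t (γ + Pi.single i 1) x).differentiableAt

lemma pd_VG {d : ℕ} (t c : ℝ) (γ : Fin d → ℕ) (i : Fin d) :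
    pd i (c • VG (d := d) t γ) = c • VG t (γ + Pi.single i 1) := by
  funext x
  ext j
  have h : HasFDerivAt (c • VG (d := d) t γ) (c • fderiv ℝ (VG t γ) x) x :=
    ((VG_diff t γ x).hasFDerivAt).const_smul c
  rw [pd, h.fderiv]
  have h3 := (EuclideanSpace.proj j : Euc d →L[ℝ] ℝ).hasFDerivAt.comp x ((VG_diff t γ x).hasFDerivAt)
  have h4 : HasFDerivAt (PG t (γ + Pi.single j 1)) ((EuclideanSpace.proj j : Euc d →L[ℝ] ℝ).comp
    (fderiv ℝ (VG t γ) x)) x := h3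
  have h5 := PG_fderiv_single t (γ + Pi.single j 1) x i
  rw [h4.fderiv] at h5
  have h6 : (fderiv ℝ (VG t γ) x (EuclideanSpace.single i 1)) j = 
      PG t (γ + Pi.single j 1 + Pi.single i 1) x := h5
  simp only [_root_.smul_apply, PiLp.smul_apply, Pi.smul_apply, h6, VG]
  rw [add_right_comm]

lemma pd_iter_VG {d : ℕ} (t c : ℝ) (γ : Fin d → ℕ) (i : Fin d) (n : ℕ) :
    (pd i)^[n] (c • VG (d := d) t γ) = c • VG t (γ + Pi.single i n) := by
  induction n with
  | zero => simp
  | succ n ih =>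
    rw [Function.iterate_succ_apply', ih, pd_VG, add_assoc, ← Pi.single_add]

lemma foldr_VG {d : ℕ} (t c : ℝ) (β : Fin d → ℕ) (l : List (Fin d)) :
    l.foldr (fun i g => (pd i)^[β i] g) (c • VG (d := d) t 0)
      = c • VG t ((l.map (fun i => Pi.single i (β i))).sum) := by
  induction l with
  | nil => simp
  | cons a l ih =>
    rw [List.foldr_cons, ih, pd_iter_VG, List.map_cons, List.sum_cons, add_comm]

lemma heatKernel_eq (d : ℕ) (t : ℝ) :
    heatKernel d t = ((4 * Real.pi * t) ^ (-(d : ℝ) / 2)) • PG t 0 := by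
  funext x
  simp only [heatKernel, PG, gk_zero, Pi.smul_apply, Pi.zero_apply, smul_eq_mul]
  rw [← Real.exp_sum, EuclideanSpace.real_norm_sq_eq, ← Finset.sum_div, Finset.sum_neg_distrib]

lemma gradHeat_eq_s3 (d : ℕ) (t : ℝ) :
    gradHeat d t = ((4 * Real.pi * t) ^ (-(d : ℝ) / 2)) • VG t 0 := by
  funext x
  rw [gradHeat]
  apply HasGradientAt.gradient
  rw [hasGradientAt_iff_hasFDerivAt]
  change HasFDerivAt (heatKernel d t) _ x
  rw [heatKernel_eq]
  refine ((PG_hasFDerivAt t 0 x).const_smul _).congr_fderiv ?_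
  ext v
  simp [VG, PiLp.inner_apply, mul_comm]

lemma mderiv_gradHeat (d : ℕ) (t : ℝ) (β : Fin d → ℕ) :
    mderiv β (gradHeat d t) = ((4 * Real.pi * t) ^ (-(d : ℝ) / 2)) • VG t β := by
  rw [mderiv, gradHeat_eq_s3, foldr_VG, ← Fin.sum_univ_def, Finset.univ_sum_single]

lemma PG_bound {d : ℕ} (t : ℝ) (ht : 0 < t) (N : ℕ) (hN : 1 ≤ N) (γ : Fin d → ℕ)
    (hγ : ∑ i, γ i = N) (x : Euc d) :
    |PG t γ x| ≤ (Real.exp (d * N / 4) * ((N : ℝ) / t) ^ ((N : ℝ) / 2)) *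
      Real.exp (-(1 / (8 * t)) * ‖x‖ ^ 2) := by
  have hN' : (0:ℝ) < N := by exact_mod_cast hN
  set r : ℝ := Real.sqrt (N * t) with hrdef
  have hr : 0 < r := Real.sqrt_pos.2 (by positivity)
  have hr2 : r ^ 2 = N * t := Real.sq_sqrt (by positivity)
  have hle : ∀ i, γ i ≤ N := fun i => hγ ▸ Finset.single_le_sum (f := γ) (fun _ _ => Nat.zero_le _) (Finset.mem_univ i)
  rw [PG, Finset.abs_prod]
  have hb : ∀ i ∈ (Finset.univ : Finset (Fin d)), |gk t (γ i) (x i)| ≤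
      (N / r) ^ (γ i) * (Real.exp (N / 4) * Real.exp (-(1 / (8 * t)) * (x i) ^ 2)) := by
    intro i _
    refine (gk_bound t ht r hr _ _).trans ?_
    have e1 : r ^ 2 / (4 * t) = N / 4 := by rw [hr2]; field_simp
    rw [e1, div_pow, div_mul_eq_mul_div]
    gcongr
    calc ((γ i).factorial : ℝ) ≤ ((γ i ^ γ i : ℕ) : ℝ) := by exact_mod_cast Nat.factorial_le_pow _
      _ ≤ (N:ℝ) ^ γ i := by push_cast; gcongr; exact_mod_cast hle i
  refine (Finset.prod_le_prod (fun _ _ => abs_nonneg _) hb).trans (le_of_eq ?_)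
  rw [Finset.prod_mul_distrib, Finset.prod_mul_distrib, Finset.prod_pow_eq_pow_sum, hγ,
    Finset.prod_const, ← Real.exp_sum, ← Finset.mul_sum, ← EuclideanSpace.real_norm_sq_eq,
    ← Real.exp_nat_mul]
  have : ((N : ℝ) / r) ^ N = ((N : ℝ) / t) ^ ((N : ℝ) / 2) := by
    have e : (N : ℝ) / t = (N / r) ^ (2:ℕ) := by
      rw [div_pow, hr2]; field_simp
    rw [e, ← Real.rpow_natCast_mul (by positivity), ← Real.rpow_natCast]
    congr 1; push_cast; ring
  rw [this]
  simp only [Finset.card_univ, Fintype.card_fin]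
  rw [mul_div_assoc]; ring

lemma VG_bound {d : ℕ} (t : ℝ) (ht : 0 < t) (β : Fin d → ℕ) (x : Euc d) :
    ‖VG t β x‖ ≤ d * (Real.exp (d * (msize β + 1 : ℝ) / 4) *
      (((msize β : ℝ) + 1) / t) ^ (((msize β : ℝ) + 1) / 2)) *
      Real.exp (-(1 / (8 * t)) * ‖x‖ ^ 2) := by
  have h1 : ‖VG t β x‖ ≤ ∑ j, |PG t (β + Pi.single j 1) x| := by
    rw [EuclideanSpace.norm_eq]
    apply Real.sqrt_le_iff.2
    refine ⟨Finset.sum_nonneg fun _ _ => abs_nonneg _, ?_⟩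
    exact Finset.sum_sq_le_sq_sum_of_nonneg (fun _ _ => abs_nonneg _)
  refine h1.trans ?_
  have h2 : ∀ j ∈ (Finset.univ : Finset (Fin d)), |PG t (β + Pi.single j 1) x| ≤ _ := fun j _ =>
    PG_bound t ht (msize β + 1) (by omega) (β + Pi.single j 1)
      (by simp [Finset.sum_add_distrib, msize]) x
  refine (Finset.sum_le_sum h2).trans (le_of_eq ?_)
  rw [Finset.sum_const, Finset.card_univ, Fintype.card_fin, nsmul_eq_mul]
  push_cast
  ring

/-- Gaussian majorant -/
def GT (d : ℕ) (t : ℝ) (x : Euc d) : ℝ≥0∞ := ENNReal.ofReal (Real.exp (-(1 / (8 * t)) * ‖x‖ ^ 2))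

lemma GT_meas (d : ℕ) (t : ℝ) : Measurable (GT d t) := by
  unfold GT; fun_prop

lemma GT_le_one (d : ℕ) (t : ℝ) (ht : 0 < t) (x : Euc d) : GT d t x ≤ 1 := by
  unfold GT
  rw [← ENNReal.ofReal_one]
  apply ENNReal.ofReal_le_ofReal
  rw [Real.exp_le_one_iff]
  have : 0 ≤ 1 / (8 * t) * ‖x‖ ^ 2 := by positivity
  linarith

lemma GT_lintegral (d : ℕ) (t : ℝ) (ht : 0 < t) :
    ∫⁻ x, GT d t x = ENNReal.ofReal ((8 * Real.pi * t) ^ ((d : ℝ) / 2)) := by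
  have hb : (0:ℝ) < 1 / (8 * t) := by positivity
  have h := GaussianFourier.integral_rexp_neg_mul_sq_norm (V := Euc d) hb
  have hpos : (0:ℝ) < (Real.pi / (1 / (8 * t))) ^ (((Module.finrank ℝ (Euc d) : ℕ) : ℝ) / 2) := by
    positivity
  have hi : Integrable (fun v : Euc d => Real.exp (-(1 / (8 * t)) * ‖v‖ ^ 2)) := by
    by_contra hc
    rw [integral_undef hc] at h
    exact hpos.ne h
  unfold GT
  rw [← ofReal_integral_eq_lintegral_ofReal hi (Eventually.of_forall fun _ => (Real.exp_pos _).le), h]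
  congr 2
  · field_simp
  · simp

/-- majorant convolution -/
def HC (d : ℕ) (t : ℝ) (f : Euc d → ℝ) (x : Euc d) : ℝ≥0∞ := ∫⁻ y, GT d t (x - y) * ‖f y‖ₑ

lemma GT_trans (d : ℕ) (t : ℝ) (x : Euc d) : ∫⁻ y, GT d t (x - y) = ∫⁻ y, GT d t y :=
  lintegral_sub_left_eq_self _ _

lemma HC_top (d : ℕ) (t : ℝ) (f : Euc d → ℝ) (x : Euc d) :
    HC d t f x ≤ (∫⁻ y, GT d t y) * eLpNorm f ⊤ volume := by
  rw [← GT_trans d t x, HC, ← lintegral_mul_const]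
  · apply lintegral_mono_ae
    filter_upwards [enorm_ae_le_eLpNormEssSup f volume] with y hy
    rw [eLpNorm_exponent_top]
    gcongr
  · exact (GT_meas d t).comp (by fun_prop)

/-- second majorant -/
def UC (d : ℕ) (t p : ℝ) (f : Euc d → ℝ) (x : Euc d) : ℝ≥0∞ := ∫⁻ y, GT d t (x - y) * ‖f y‖ₑ ^ p

lemma HC_le (d : ℕ) (t : ℝ) (f : Euc d → ℝ) (hf : AEStronglyMeasurable f volume) (p : ℝ)
    (hp : 1 ≤ p) (x : Euc d) :
    HC d t f x ≤ (∫⁻ y, GT d t y) ^ (1 - 1 / p) * (UC d t p f x) ^ (1 / p) := by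
  have hp0 : 0 < p := by linarith
  have hm : Measurable fun y => GT d t (x - y) := (GT_meas d t).comp (by fun_prop)
  have hp1 : 1 / p ≤ 1 := by rw [div_le_one hp0]; exact hp
  have h := ENNReal.lintegral_mul_norm_pow_le (μ := (volume : Measure (Euc d)))
    (f := fun y => GT d t (x - y)) (g := fun y => GT d t (x - y) * ‖f y‖ₑ ^ p)
    hm.aemeasurable (hm.aemeasurable.mul (hf.enorm.pow_const p))
    (p := 1 - 1 / p) (q := 1 / p) (by linarith) (by positivity) (by ring)
  rw [GT_trans] at h
  refine le_trans (le_of_eq ?_) h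
  unfold HC
  congr 1
  funext y
  rw [ENNReal.mul_rpow_of_nonneg _ _ (by positivity), ← mul_assoc,
    ← ENNReal.rpow_add_of_nonneg _ _ (by linarith) (by positivity), ← ENNReal.rpow_mul]
  rw [mul_one_div_cancel hp0.ne']
  simp

lemma UC_le (d : ℕ) (t : ℝ) (ht : 0 < t) (f : Euc d → ℝ) (p : ℝ) (x : Euc d) :
    UC d t p f x ≤ ∫⁻ y, ‖f y‖ₑ ^ p := by
  apply lintegral_mono
  intro y
  calc GT d t (x - y) * ‖f y‖ₑ ^ p ≤ 1 * ‖f y‖ₑ ^ p := by gcongr; exact GT_le_one d t ht _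
    _ = _ := one_mul _

lemma UC_int (d : ℕ) (t : ℝ) (f : Euc d → ℝ) (hf : AEStronglyMeasurable f volume) (p : ℝ) :
    ∫⁻ x, UC d t p f x = (∫⁻ y, GT d t y) * ∫⁻ y, ‖f y‖ₑ ^ p := by
  unfold UC
  rw [lintegral_lintegral_swap]
  · rw [← lintegral_const_mul'' _ (hf.enorm.pow_const p)]
    congr 1
    funext y
    rw [lintegral_mul_const]
    · rw [lintegral_sub_right_eq_self (fun x => GT d t x) y]
    · exact (GT_meas d t).comp (by fun_prop)
  · apply AEMeasurable.mul
    · exact ((GT_meas d t).comp (measurable_fst.sub measurable_snd)).aemeasurable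
    · exact ((hf.enorm.pow_const p).comp_quasiMeasurePreserving Measure.quasiMeasurePreserving_snd)

lemma HC_Lq (d : ℕ) (t : ℝ) (ht : 0 < t) (p q : ℝ≥0∞) (hp : 1 ≤ p) (hpq : p ≤ q)
    (f : Euc d → ℝ) (hf : MemLp f p volume) :
    eLpNorm (HC d t f) q volume ≤
      (∫⁻ y, GT d t y) ^ (1 - (p⁻¹.toReal - q⁻¹.toReal)) * eLpNorm f p volume := by
  set M := ∫⁻ y, GT d t y with hM
  rcases eq_or_ne p ⊤ with rfl | hpt
  · obtain rfl : q = ⊤ := top_le_iff.1 hpq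
    simp only [ENNReal.inv_top, ENNReal.toReal_zero, sub_self, sub_zero, ENNReal.rpow_one]
    rw [eLpNorm_exponent_top (f := HC d t f)]
    refine eLpNormEssSup_le_of_ae_enorm_bound (Eventually.of_forall fun x => ?_)
    exact HC_top d t f x
  have hp0 : p ≠ 0 := (zero_lt_one.trans_le hp).ne'
  set P := p.toReal with hP
  have hP1 : 1 ≤ P := by
    rw [hP, ← ENNReal.toReal_one]; exact ENNReal.toReal_mono hpt hp
  have hP0 : 0 < P := by linarith
  have hM0 : M ≠ 0 := by
    rw [hM, GT_lintegral d t ht]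
    exact (ENNReal.ofReal_pos.2 (by positivity)).ne'
  have hMt : M ≠ ⊤ := by
    rw [hM, GT_lintegral d t ht]
    exact ENNReal.ofReal_ne_top
  have hfn := eLpNorm_eq_lintegral_rpow_enorm_toReal (μ := (volume : Measure (Euc d))) hp0 hpt (f := f)
  set Fp := ∫⁻ y, ‖f y‖ₑ ^ P with hFp
  have hFt : Fp ≠ ⊤ := by
    intro h
    have := hf.2.ne
    rw [hfn, h, ENNReal.top_rpow_of_pos (by positivity)] at this
    exact this rfl
  rw [hfn, ENNReal.toReal_inv, ENNReal.toReal_inv, ← hP]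
  rcases eq_or_ne q ⊤ with rfl | hqt
  · simp only [ENNReal.toReal_top, inv_zero, sub_zero]
    rw [eLpNorm_exponent_top (f := HC d t f)]
    refine eLpNormEssSup_le_of_ae_enorm_bound (Eventually.of_forall fun x => ?_)
    refine (HC_le d t f hf.1 P hP1 x).trans ?_
    rw [← one_div, ← hM]
    gcongr
    exact UC_le d t ht f P x
  have hq0 : q ≠ 0 := (zero_lt_one.trans_le (hp.trans hpq)).ne'
  rw [eLpNorm_eq_lintegral_rpow_enorm_toReal hq0 hqt]
  set Q := q.toReal with hQ
  have hPQ : P ≤ Q := ENNReal.toReal_mono hqt hpq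
  have hQ0 : 0 < Q := by linarith
  have hPQ1 : 1 ≤ Q / P := by rw [le_div_iff₀ hP0]; linarith
  have key : ∀ x, ‖HC d t f x‖ₑ ^ Q ≤ (M ^ (Q - Q / P) * Fp ^ (Q / P - 1)) * UC d t P f x := by
    intro x
    rw [enorm_eq_self]
    have h1 := ENNReal.rpow_le_rpow (HC_le d t f hf.1 P hP1 x) hQ0.le
    rw [ENNReal.mul_rpow_of_nonneg _ _ hQ0.le, ← ENNReal.rpow_mul, ← ENNReal.rpow_mul, ← hM] at h1
    refine h1.trans ?_
    have e1 : (1 - 1 / P) * Q = Q - Q / P := by ring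
    have e2 : 1 / P * Q = (Q / P - 1) + 1 := by ring
    rw [e1, e2, ENNReal.rpow_add_of_nonneg _ _ (by linarith) zero_le_one, ENNReal.rpow_one, ← mul_assoc]
    gcongr
    exact UC_le d t ht f P x
  have h2 := lintegral_mono (μ := (volume : Measure (Euc d))) key
  rw [lintegral_const_mul' _ _ ?_, UC_int d t f hf.1 P, ← hM, ← hFp] at h2
  swap
  · refine ENNReal.mul_ne_top (ENNReal.rpow_ne_top_of_ne_zero hM0 hMt)
      (ENNReal.rpow_ne_top_of_nonneg (by linarith) hFt)
  have h3 := ENNReal.rpow_le_rpow h2 (z := 1 / Q) (by positivity)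
  refine h3.trans (le_of_eq ?_)
  have e3 : M ^ (Q - Q / P) * Fp ^ (Q / P - 1) * (M * Fp) = M ^ (Q - Q / P + 1) * Fp ^ (Q / P) := by
    rw [ENNReal.rpow_add _ _ hM0 hMt, ENNReal.rpow_one]
    have : Fp ^ (Q / P) = Fp ^ (Q / P - 1) * Fp := by
      conv_lhs => rw [show Q / P = (Q / P - 1) + 1 by ring,
        ENNReal.rpow_add_of_nonneg _ _ (by linarith) zero_le_one, ENNReal.rpow_one]
    rw [this]; ring
  rw [e3, ENNReal.mul_rpow_of_nonneg _ _ (by positivity), ← ENNReal.rpow_mul, ← ENNReal.rpow_mul]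
  congr 2
  · field_simp; ring
  · field_simp

lemma convV_le (d : ℕ) (t : ℝ) (K : Euc d → Euc d) (A : ℝ) (hA : 0 ≤ A)
    (hK : ∀ x, ‖K x‖ ≤ A * Real.exp (-(1 / (8 * t)) * ‖x‖ ^ 2)) (f : Euc d → ℝ) (x : Euc d) :
    ‖convV K f x‖ₑ ≤ ENNReal.ofReal A * HC d t f x := by
  unfold convV HC
  refine (enorm_integral_le_lintegral_enorm _).trans ?_
  rw [← lintegral_const_mul' _ _ ENNReal.ofReal_ne_top]
  refine lintegral_mono fun y => ?_
  rw [enorm_smul, mul_comm, ← mul_assoc, GT, ← ENNReal.ofReal_mul hA]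
  gcongr
  rw [← ofReal_norm]
  exact ENNReal.ofReal_le_ofReal (hK _)

lemma convV_Lq (d : ℕ) (t : ℝ) (ht : 0 < t) (K : Euc d → Euc d) (A : ℝ) (hA : 0 ≤ A)
    (hK : ∀ x, ‖K x‖ ≤ A * Real.exp (-(1 / (8 * t)) * ‖x‖ ^ 2))
    (p q : ℝ≥0∞) (hp : 1 ≤ p) (hpq : p ≤ q) (f : Euc d → ℝ) (hf : MemLp f p volume) :
    eLpNorm (convV K f) q volume ≤ ENNReal.ofReal (A *
      ((8 * Real.pi * t) ^ ((d : ℝ) / 2)) ^ (1 - (p⁻¹.toReal - q⁻¹.toReal)) *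
        (eLpNorm f p volume).toReal) := by
  have h1 : eLpNorm (convV K f) q volume ≤ ENNReal.ofReal A * eLpNorm (HC d t f) q volume := by
    have h := eLpNorm_le_mul_eLpNorm_of_ae_le_mul' (μ := (volume : Measure (Euc d)))
      (f := convV K f) (g := HC d t f) (c := A.toNNReal) (Eventually.of_forall (convV_le d t K A hA hK f)) q
    exact h
  refine h1.trans ?_
  rw [ENNReal.ofReal_mul (by positivity), ENNReal.ofReal_mul hA, ENNReal.ofReal_toReal hf.2.ne,
    mul_assoc, ← ENNReal.ofReal_rpow_of_pos (by positivity), ← GT_lintegral d t ht]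
  gcongr
  exact HC_Lq d t ht p q hp hpq f hf

lemma final_const (d : ℕ) (hd : 1 ≤ d) (n : ℕ) (hn : 1 ≤ n) (t δ : ℝ) (ht : 0 < t) (h0 : 0 ≤ δ)
    (h1 : δ ≤ 1) :
    ((4 * Real.pi * t) ^ (-(d : ℝ) / 2) * (d * (Real.exp (d * ((n : ℝ) + 1) / 4) *
      (((n : ℝ) + 1) / t) ^ (((n : ℝ) + 1) / 2)))) *
      ((8 * Real.pi * t) ^ ((d : ℝ) / 2)) ^ (1 - δ) ≤
    (((d : ℝ) * Real.exp (d / 2) * 4 * 2 ^ d) ^ 2) ^ ((n : ℝ) / 2) *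
      ((n : ℝ) / 2) ^ (((n : ℝ) + 1) / 2 + ((d : ℝ) / 2) * δ) *
      t ^ (-(((n : ℝ) + 1) / 2) - ((d : ℝ) / 2) * δ) := by
  have hd' : (1:ℝ) ≤ d := by exact_mod_cast hd
  have hn' : (1:ℝ) ≤ n := by exact_mod_cast hn
  have hn0 : (0:ℝ) < n := by linarith
  have hpi := Real.pi_gt_three
  set D : ℝ := (d : ℝ) / 2 with hD
  have hD0 : 0 ≤ D := by positivity
  set a : ℝ := ((n : ℝ) + 1) / 2 with ha
  have ha0 : 0 ≤ a := by positivity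
  have s1 : (4 * Real.pi * t) ^ (-(d : ℝ) / 2) * ((8 * Real.pi * t) ^ D) ^ (1 - δ)
      ≤ 2 ^ D * t ^ (-(D * δ)) := by
    have e1 : (4 * Real.pi * t) ^ (-(d : ℝ) / 2) = 2 ^ D * (8 * Real.pi * t) ^ (-D) := by
      have : 4 * Real.pi * t = (8 * Real.pi * t) * (2:ℝ)⁻¹ := by ring
      rw [this, Real.mul_rpow (by positivity) (by positivity), neg_div, ← hD,
        Real.inv_rpow (by norm_num), ← Real.rpow_neg (by norm_num), neg_neg, mul_comm]
    rw [e1, ← Real.rpow_mul (by positivity), mul_assoc, ← Real.rpow_add (by positivity)]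
    have : -D + D * (1 - δ) = -(D * δ) := by ring
    rw [this, Real.mul_rpow (by positivity) ht.le]
    have : (8 * Real.pi) ^ (-(D * δ)) ≤ 1 :=
      Real.rpow_le_one_of_one_le_of_nonpos (by linarith) (by have := mul_nonneg hD0 h0; linarith)
    have ht' : 0 ≤ t ^ (-(D * δ)) := by positivity
    gcongr
    nlinarith
  have s2 : (((n : ℝ) + 1) / t) ^ a ≤ 4 ^ n * ((n : ℝ) / 2) ^ a * t ^ (-a) := by
    rw [Real.div_rpow (by positivity) ht.le, Real.rpow_neg ht.le, div_eq_mul_inv]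
    gcongr
    calc ((n:ℝ) + 1) ^ a ≤ (4 * ((n:ℝ) / 2)) ^ a := by
          apply Real.rpow_le_rpow (by positivity) (by linarith) ha0
      _ = 4 ^ a * ((n : ℝ) / 2) ^ a := Real.mul_rpow (by norm_num) (by positivity)
      _ ≤ _ := by
          gcongr
          rw [← Real.rpow_natCast]
          exact Real.rpow_le_rpow_of_exponent_le (by norm_num) (by rw [ha]; linarith)
  have s3 : 1 ≤ 2 ^ D * ((n : ℝ) / 2) ^ (D * δ) := by
    have hx : ((1:ℝ) / 2) ^ D ≤ ((n : ℝ) / 2) ^ (D * δ) :=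
      calc ((1:ℝ) / 2) ^ D ≤ (1 / 2) ^ (D * δ) :=
            Real.rpow_le_rpow_of_exponent_ge (by norm_num) (by norm_num) (by nlinarith)
        _ ≤ _ := Real.rpow_le_rpow (by norm_num) (by linarith) (by positivity)
    calc (1:ℝ) = 2 ^ D * (1 / 2) ^ D := by
          rw [← Real.mul_rpow (by norm_num) (by norm_num)]; norm_num
      _ ≤ _ := by gcongr
  have s4 : Real.exp (d * ((n : ℝ) + 1) / 4) ≤ Real.exp (d / 2) ^ n := by
    rw [← Real.exp_nat_mul]
    apply Real.exp_le_exp.2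
    nlinarith
  have s5 : (d : ℝ) ≤ d ^ n := le_self_pow₀ hd' (by omega)
  have s6 : (2:ℝ) ^ D * 2 ^ D ≤ (2 ^ d) ^ n := by
    rw [← Real.rpow_add (by norm_num), hD, add_halves, Real.rpow_natCast]
    exact le_self_pow₀ (one_le_pow₀ (by norm_num)) (by omega)
  have s7 : (((d : ℝ) * Real.exp (d / 2) * 4 * 2 ^ d) ^ 2) ^ ((n : ℝ) / 2)
      = d ^ n * Real.exp (d / 2) ^ n * 4 ^ n * (2 ^ d) ^ n := by
    rw [← Real.rpow_natCast_mul (by positivity)]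
    have : ((2:ℕ) : ℝ) * ((n:ℝ) / 2) = n := by push_cast; ring
    rw [this, Real.rpow_natCast, mul_pow, mul_pow, mul_pow]
  rw [s7, Real.rpow_add (by positivity), sub_eq_add_neg (-a), Real.rpow_add ht]
  calc _ = (d * Real.exp (d * ((n : ℝ) + 1) / 4)) * (((n : ℝ) + 1) / t) ^ a *
        ((4 * Real.pi * t) ^ (-(d : ℝ) / 2) * ((8 * Real.pi * t) ^ D) ^ (1 - δ)) * 1 := by ring
    _ ≤ (d ^ n * Real.exp (d / 2) ^ n) * (4 ^ n * ((n : ℝ) / 2) ^ a * t ^ (-a)) *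
        (2 ^ D * t ^ (-(D * δ))) * (2 ^ D * ((n : ℝ) / 2) ^ (D * δ)) := by gcongr
    _ = d ^ n * Real.exp (d / 2) ^ n * 4 ^ n * (2 ^ D * 2 ^ D) *
        (((n : ℝ) / 2) ^ a * ((n : ℝ) / 2) ^ (D * δ)) * (t ^ (-a) * t ^ (-(D * δ))) := by ring
    _ ≤ _ := by gcongr

/-- `L^p → L^q` smoothing of spatial derivatives of the gradient of the
heat semigroup. -/
theorem heatKernel_grad_spatial_deriv_conv_Lp_Lq_bound (d : ℕ) (hd : 1 ≤ d) :
    ∃ C₀ : ℝ, 0 < C₀ ∧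
      ∀ (β : Fin d → ℕ), β ≠ 0 → ∀ (p q : ℝ≥0∞), 1 ≤ p → p ≤ q →
        ∀ f : Euc d → ℝ, MemLp f p volume → ∀ t : ℝ, 0 < t →
          eLpNorm (convV (mderiv β (gradHeat d t)) f) q volume ≤
            ENNReal.ofReal
              (C₀ ^ ((msize β : ℝ) / 2) *
                ((msize β : ℝ) / 2) ^
                  (((msize β : ℝ) + 1) / 2 + ((d : ℝ) / 2) * (p⁻¹.toReal - q⁻¹.toReal)) *
                t ^ (-(((msize β : ℝ) + 1) / 2) - ((d : ℝ) / 2) * (p⁻¹.toReal - q⁻¹.toReal)) *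
                (eLpNorm f p volume).toReal) := by
  refine ⟨((d : ℝ) * Real.exp (d / 2) * 4 * 2 ^ d) ^ 2, by positivity, ?_⟩
  intro β hβ p q hp hpq f hf t ht
  have hn : 1 ≤ msize β := by
    rw [Nat.one_le_iff_ne_zero]
    intro h
    apply hβ
    funext i
    exact (Finset.sum_eq_zero_iff.1 h) i (Finset.mem_univ i)
  have hinv : q⁻¹ ≤ p⁻¹ := ENNReal.inv_le_inv.2 hpq
  have hp1 : p⁻¹ ≤ 1 := ENNReal.inv_le_one.2 hp
  have hpt : p⁻¹ ≠ ⊤ := ne_top_of_le_ne_top ENNReal.one_ne_top hp1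
  have h0 : q⁻¹.toReal ≤ p⁻¹.toReal := ENNReal.toReal_mono hpt hinv
  have h1 : p⁻¹.toReal ≤ 1 := by
    rw [← ENNReal.toReal_one]; exact ENNReal.toReal_mono ENNReal.one_ne_top hp1
  have h2 : 0 ≤ q⁻¹.toReal := ENNReal.toReal_nonneg
  refine (convV_Lq d t ht (mderiv β (gradHeat d t))
    ((4 * Real.pi * t) ^ (-(d : ℝ) / 2) * (d * (Real.exp (d * ((msize β : ℝ) + 1) / 4) *
      (((msize β : ℝ) + 1) / t) ^ (((msize β : ℝ) + 1) / 2)))) (by positivity) ?_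
      p q hp hpq f hf).trans ?_
  · intro x
    rw [mderiv_gradHeat, Pi.smul_apply, norm_smul, Real.norm_of_nonneg (by positivity),
      mul_assoc ((4 * Real.pi * t) ^ (-(d : ℝ) / 2))]
    exact mul_le_mul_of_nonneg_left (VG_bound t ht β x) (by positivity)
  · apply ENNReal.ofReal_le_ofReal
    refine mul_le_mul_of_nonneg_right ?_ ENNReal.toReal_nonneg
    exact final_const d hd (msize β) hn t (p⁻¹.toReal - q⁻¹.toReal) ht (by linarith) (by linarith)

end
end

section
/- Let d ∈ ℕ, d ≥ 1, let 1 ≤ p < q ≤ ∞ and let f ∈ L^p(ℝ^d). Then lim_{t→0⁺} t^{(d/2)(1/p−1/q)} ‖G(·,t) ∗ f‖_{L^q(ℝ^d)} = 0. -/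
open MeasureTheory Real Filter
open scoped ENNReal BigOperators Topology

noncomputable section

def kU {d : ℕ} (k g : Euc d → ℝ≥0∞) (x : Euc d) : ℝ≥0∞ := ∫⁻ y, k (x - y) * g y

lemma kU_meas {d : ℕ} {k g : Euc d → ℝ≥0∞} (hk : Measurable k) (hg : Measurable g) :
    Measurable (kU k g) := by
  unfold kU
  apply Measurable.lintegral_prod_right
  fun_prop

lemma kU_jensen {d : ℕ} {k g : Euc d → ℝ≥0∞} (hk : Measurable k) (hg : Measurable g)
    (h1 : ∫⁻ y, k y = 1) {P : ℝ} (hP : 1 ≤ P) (x : Euc d) :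
    (kU k g x) ^ P ≤ ∫⁻ y, k (x - y) * g y ^ P := by
  have hkx : Measurable (fun y => k (x - y)) := by fun_prop
  let μ : Measure (Euc d) := volume.withDensity (fun y => k (x - y))
  have : IsProbabilityMeasure μ := ⟨by
    simp only [μ, withDensity_apply _ MeasurableSet.univ, Measure.restrict_univ]
    rw [lintegral_sub_left_eq_self (fun y => k y) x, h1]⟩
  have key := eLpNorm'_le_eLpNorm'_of_exponent_le (f := g) one_pos hP μ
    hg.aestronglyMeasurable
  simp only [eLpNorm', enorm_eq_self, ENNReal.rpow_one, div_one] at key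
  have e1 : ∫⁻ y, g y ∂μ = kU k g x := by
    simp only [μ]; rw [lintegral_withDensity_eq_lintegral_mul _ hkx hg]; rfl
  have e2 : ∫⁻ y, g y ^ P ∂μ = ∫⁻ y, k (x - y) * g y ^ P := by
    simp only [μ]; rw [lintegral_withDensity_eq_lintegral_mul _ hkx (by fun_prop)]; rfl
  rw [e1, e2] at key
  have := ENNReal.rpow_le_rpow key (by linarith : 0 ≤ P)
  rwa [← ENNReal.rpow_mul, one_div, inv_mul_cancel₀ (by linarith), ENNReal.rpow_one] at this

lemma kU_contr {d : ℕ} {k g : Euc d → ℝ≥0∞} (hk : Measurable k) (hg : Measurable g)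
    (h1 : ∫⁻ y, k y = 1) {P : ℝ} (hP : 1 ≤ P) :
    ∫⁻ x, (kU k g x) ^ P ≤ ∫⁻ y, g y ^ P := by
  calc ∫⁻ x, (kU k g x) ^ P ≤ ∫⁻ x, ∫⁻ y, k (x - y) * g y ^ P :=
        lintegral_mono (kU_jensen hk hg h1 hP)
    _ = ∫⁻ y, ∫⁻ x, k (x - y) * g y ^ P := by
        apply lintegral_lintegral_swap
        apply Measurable.aemeasurable
        fun_prop
    _ = ∫⁻ y, g y ^ P := by
        congr 1; ext y
        rw [lintegral_mul_const _ (by fun_prop), lintegral_sub_right_eq_self (fun x => k x) y, h1,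
          one_mul]

lemma kU_sup {d : ℕ} {k g : Euc d → ℝ≥0∞} (hk : Measurable k) (hg : Measurable g)
    (h1 : ∫⁻ y, k y = 1) {P : ℝ} (hP : 1 ≤ P) {c : ℝ≥0∞} (hc : ∀ x, k x ≤ c) (x : Euc d) :
    kU k g x ≤ c ^ (1 / P) * (∫⁻ y, g y ^ P) ^ (1 / P) := by
  rw [← ENNReal.mul_rpow_of_nonneg _ _ (by positivity), one_div,
    ENNReal.le_rpow_inv_iff (by linarith)]
  refine (kU_jensen hk hg h1 hP x).trans ?_
  rw [← lintegral_const_mul _ (by fun_prop)]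
  exact lintegral_mono fun y => mul_le_mul_left (hc _) _

lemma kU_interp {d : ℕ} {U : Euc d → ℝ≥0∞} (hU : Measurable U) {A B : ℝ≥0∞}
    (hA : ∀ x, U x ≤ A) {p q : ℝ≥0∞} (hp : 1 ≤ p) (hpq : p < q)
    (hB : (∫⁻ x, U x ^ p.toReal) ^ (1 / p.toReal) ≤ B) :
    eLpNorm U q volume ≤
      A ^ (1 - p.toReal * q⁻¹.toReal) * B ^ (p.toReal * q⁻¹.toReal) := by
  have hpt : p ≠ ⊤ := hpq.ne_top
  have hP : 1 ≤ p.toReal := by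
    rw [← ENNReal.toReal_one]; exact ENNReal.toReal_mono hpt hp
  by_cases hq : q = ⊤
  · subst hq
    simp only [ENNReal.inv_top, ENNReal.toReal_zero, mul_zero, sub_zero, ENNReal.rpow_one,
      ENNReal.rpow_zero, mul_one, eLpNorm_exponent_top]
    exact essSup_le_of_ae_le _ (Eventually.of_forall hA)
  have hPQ : p.toReal < q.toReal := (ENNReal.toReal_lt_toReal hpt hq).2 hpq
  have hq0 : q ≠ 0 := (hpq.trans_le' (zero_le)).ne'
  rw [eLpNorm_eq_lintegral_rpow_enorm_toReal hq0 hq, ENNReal.toReal_inv]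
  set P := p.toReal
  set Q := q.toReal
  have hQ : 0 < Q := by linarith
  have h2 : ∫⁻ x, ‖U x‖ₑ ^ Q ≤ A ^ (Q - P) * B ^ P := by
    calc ∫⁻ x, ‖U x‖ₑ ^ Q ≤ ∫⁻ x, A ^ (Q - P) * U x ^ P := by
          refine lintegral_mono fun x => ?_
          have : U x ^ Q = U x ^ (Q - P) * U x ^ P := by
            rw [← ENNReal.rpow_add_of_nonneg _ _ (by linarith) (by linarith), sub_add_cancel]
          simp only [enorm_eq_self, this]
          exact mul_le_mul_left (ENNReal.rpow_le_rpow (hA x) (by linarith)) _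
      _ = A ^ (Q - P) * ∫⁻ x, U x ^ P := lintegral_const_mul _ (by fun_prop)
      _ ≤ _ := by
          gcongr
          rwa [one_div, ENNReal.rpow_inv_le_iff (by linarith)] at hB
  refine (ENNReal.rpow_le_rpow h2 (by positivity : 0 ≤ 1 / Q)).trans (le_of_eq ?_)
  rw [ENNReal.mul_rpow_of_nonneg _ _ (by positivity), ← ENNReal.rpow_mul, ← ENNReal.rpow_mul]
  congr 2
  · field_simp
  · rw [one_div]

lemma heat_lint {d : ℕ} {t : ℝ} (ht : 0 < t) :
    ∫⁻ x : Euc d, ENNReal.ofReal (heatKernel d t x) = 1 := by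
  have hb : 0 < 1 / (4 * t) := by positivity
  have e := GaussianFourier.integral_rexp_neg_mul_sq_norm (V := Euc d) hb
  have hpos : (0:ℝ) < 4 * π * t := by positivity
  have e2 : π / (1 / (4 * t)) = 4 * π * t := by field_simp
  rw [e2, finrank_euclideanSpace_fin] at e
  have hint : Integrable (fun v : Euc d => rexp (-(1 / (4 * t)) * ‖v‖ ^ 2)) := by
    by_contra h
    rw [integral_undef h] at e
    exact (Real.rpow_pos_of_pos hpos _).ne e
  have hk : heatKernel d t = fun v : Euc d =>
      (4 * π * t) ^ (-(d : ℝ) / 2) * rexp (-(1 / (4 * t)) * ‖v‖ ^ 2) := by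
    ext v; unfold heatKernel; congr 2; ring
  rw [hk, ← ofReal_integral_eq_lintegral_ofReal (hint.const_mul _)
    (Eventually.of_forall fun v => by positivity), integral_const_mul, e,
    ← Real.rpow_add hpos]
  rw [show -(d : ℝ) / 2 + d / 2 = 0 by ring]; simp

lemma heat_meas (d : ℕ) (t : ℝ) : Measurable fun x : Euc d => ENNReal.ofReal (heatKernel d t x) := by
  unfold heatKernel; fun_prop

lemma heat_sup {d : ℕ} {t : ℝ} (ht : 0 < t) (x : Euc d) :
    ENNReal.ofReal (heatKernel d t x) ≤ ENNReal.ofReal ((4 * π * t) ^ (-(d : ℝ) / 2)) := by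
  apply ENNReal.ofReal_le_ofReal
  unfold heatKernel
  apply mul_le_of_le_one_right (by positivity)
  rw [Real.exp_le_one_iff]
  apply div_nonpos_of_nonpos_of_nonneg _ (by positivity)
  have := sq_nonneg ‖x‖
  linarith

lemma weight_le {s e t : ℝ} (hs : 0 ≤ s) (he : 0 ≤ e) (ht : 0 < t) :
    ENNReal.ofReal (t ^ (s * e)) * ENNReal.ofReal ((4 * π * t) ^ (-s)) ^ e ≤ 1 := by
  rw [ENNReal.ofReal_rpow_of_pos (by positivity), ← ENNReal.ofReal_mul (by positivity),
    ENNReal.ofReal_le_one, Real.rpow_mul ht.le, ← Real.mul_rpow (by positivity) (by positivity)]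
  apply Real.rpow_le_one (by positivity) _ he
  rw [Real.rpow_neg (by positivity), ← div_eq_mul_inv, div_le_one (by positivity)]
  apply Real.rpow_le_rpow ht.le _ hs
  have := Real.pi_gt_three
  nlinarith

/-- vanishing limit of the weighted `L^q` norm of the heat semigroup
as `t → 0⁺`, for `f ∈ L^p` and `p < q`. -/
theorem heatSemigroup_weighted_Lq_tendsto_zero (d : ℕ) (hd : 1 ≤ d)
    (p q : ℝ≥0∞) (hp : 1 ≤ p) (hpq : p < q)
    (f : Euc d → ℝ) (hf : MemLp f p volume) :
    Filter.Tendsto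
      (fun t : ℝ =>
        ENNReal.ofReal (t ^ (((d : ℝ) / 2) * (p⁻¹.toReal - q⁻¹.toReal))) *
          eLpNorm (conv (heatKernel d t) f) q volume)
      (nhdsWithin 0 (Set.Ioi 0)) (nhds 0) := by
  have hpt : p ≠ ⊤ := hpq.ne_top
  have hp0 : p ≠ 0 := (zero_lt_one.trans_le hp).ne'
  have hP : 1 ≤ p.toReal := by
    rw [← ENNReal.toReal_one]; exact ENNReal.toReal_mono hpt hp
  have hab : 0 < p⁻¹.toReal - q⁻¹.toReal := by
    rw [sub_pos]
    exact (ENNReal.toReal_lt_toReal (ENNReal.inv_ne_top.2 (hpq.trans_le' zero_le).ne')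
      (ENNReal.inv_ne_top.2 hp0)).2 (ENNReal.inv_lt_inv.2 hpq)
  have ha : p⁻¹.toReal = 1 / p.toReal := by rw [ENNReal.toReal_inv, one_div]
  have hb0 : 0 ≤ q⁻¹.toReal := ENNReal.toReal_nonneg
  have hth : p.toReal * q⁻¹.toReal ≤ 1 := by
    have : q⁻¹.toReal < 1 / p.toReal := by linarith
    rw [lt_div_iff₀ (by linarith)] at this
    linarith
  have hd' : (0:ℝ) < d := by exact_mod_cast hd
  rw [ENNReal.tendsto_nhds_zero]
  intro ε hε
  have hε2 : ε / 2 ≠ 0 := (ENNReal.half_pos hε.ne').ne'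
  obtain ⟨g, hg, hgm⟩ := hf.exists_boundedContinuous_eLpNorm_sub_le hpt hε2
  have hh : MemLp (f - (g : Euc d → ℝ)) p volume := hf.sub hgm
  set h := hh.1.mk with hhdef
  have hhm : Measurable h := hh.1.stronglyMeasurable_mk.measurable
  have hhe : (f - (g : Euc d → ℝ)) =ᵐ[volume] h := hh.1.ae_eq_mk
  have hN : (∫⁻ y, ‖h y‖ₑ ^ p.toReal) ^ (1 / p.toReal) ≤ ε / 2 := by
    rw [← eLpNorm_eq_lintegral_rpow_enorm_toReal hp0 hpt, ← eLpNorm_congr_ae hhe]; exact hg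
  have hNg : (∫⁻ y, ‖g y‖ₑ ^ p.toReal) ^ (1 / p.toReal) ≠ ⊤ := by
    rw [← eLpNorm_eq_lintegral_rpow_enorm_toReal hp0 hpt]; exact hgm.2.ne
  set N := (∫⁻ y, ‖h y‖ₑ ^ p.toReal) ^ (1 / p.toReal)
  set Ng := (∫⁻ y, ‖g y‖ₑ ^ p.toReal) ^ (1 / p.toReal)
  set θ := p.toReal * q⁻¹.toReal with hθ
  have hθ0 : 0 ≤ θ := by positivity
  set C : ℝ≥0∞ := ‖g‖ₑ ^ (1 - θ) * Ng ^ θ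
  have hC : C ≠ ⊤ := ENNReal.mul_ne_top
    (ENNReal.rpow_ne_top_of_nonneg (by linarith) enorm_ne_top)
    (ENNReal.rpow_ne_top_of_nonneg hθ0 hNg)
  have hexp : 0 < ((d : ℝ) / 2) * (p⁻¹.toReal - q⁻¹.toReal) := by positivity
  set w : ℝ → ℝ≥0∞ := fun t => ENNReal.ofReal (t ^ (((d : ℝ) / 2) * (p⁻¹.toReal - q⁻¹.toReal)))
  have hw : Tendsto (fun t => w t * C) (𝓝[>] 0) (𝓝 0) := by
    have h1 : Tendsto (fun t : ℝ => t ^ (((d : ℝ) / 2) * (p⁻¹.toReal - q⁻¹.toReal)))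
        (𝓝[>] 0) (𝓝 0) := by
      have := (Real.continuousAt_rpow_const 0 _ (Or.inr hexp.le)).tendsto
      rw [Real.zero_rpow hexp.ne'] at this
      exact this.mono_left nhdsWithin_le_nhds
    have h2 := ENNReal.Tendsto.mul_const (ENNReal.tendsto_ofReal h1) (Or.inr hC)
    rw [ENNReal.ofReal_zero, zero_mul] at h2
    exact h2
  filter_upwards [ENNReal.tendsto_nhds_zero.1 hw (ε / 2) (ENNReal.half_pos hε.ne'),
    self_mem_nhdsWithin] with t htC ht
  have ht : 0 < t := ht
  set k : Euc d → ℝ≥0∞ := fun x => ENNReal.ofReal (heatKernel d t x)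
  have hkm : Measurable k := heat_meas d t
  have hk1 : ∫⁻ x, k x = 1 := heat_lint ht
  have hge : Measurable fun y => ‖g y‖ₑ := g.continuous.measurable.enorm
  have hhme : Measurable fun y => ‖h y‖ₑ := hhm.enorm
  have hle : eLpNorm (conv (heatKernel d t) f) q volume ≤
      eLpNorm (kU k (fun y => ‖g y‖ₑ) + kU k (fun y => ‖h y‖ₑ)) q volume := by
    apply eLpNorm_mono_enorm
    intro x
    rw [enorm_eq_self]
    refine (enorm_integral_le_lintegral_enorm _).trans ?_
    simp only [Pi.add_apply, kU]
    rw [← lintegral_add_left (by fun_prop)]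
    apply lintegral_mono_ae
    filter_upwards [hhe] with y hy
    have hk0 : 0 ≤ heatKernel d t (x - y) := by unfold heatKernel; positivity
    rw [enorm_mul, Real.enorm_of_nonneg hk0, ← mul_add]
    gcongr
    rw [← hy]
    calc ‖f y‖ₑ = ‖g y + (f y - g y)‖ₑ := by congr 1; ring
      _ ≤ _ := enorm_add_le _ _
  have hq1 : 1 ≤ q := hp.trans hpq.le
  have hgU : eLpNorm (kU k (fun y => ‖g y‖ₑ)) q volume ≤ C := by
    apply kU_interp (kU_meas hkm hge) _ hp hpq
    · exact ENNReal.rpow_le_rpow (kU_contr hkm hge hk1 hP) (by positivity)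
    · intro x
      calc kU k (fun y => ‖g y‖ₑ) x ≤ ∫⁻ y, k (x - y) * ‖g‖ₑ := by
            refine lintegral_mono fun y => ?_
            gcongr
            rw [enorm_le_iff_norm_le]
            exact g.norm_coe_le_norm y
        _ = ‖g‖ₑ := by
            rw [lintegral_mul_const _ (by fun_prop),
              lintegral_sub_left_eq_self (fun y => k y) x, hk1, one_mul]
  set c := ENNReal.ofReal ((4 * π * t) ^ (-(d : ℝ) / 2))
  have hhU : eLpNorm (kU k (fun y => ‖h y‖ₑ)) q volume ≤
      (c ^ (1 / p.toReal) * N) ^ (1 - θ) * N ^ θ := by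
    apply kU_interp (kU_meas hkm hhme) _ hp hpq
    · exact ENNReal.rpow_le_rpow (kU_contr hkm hhme hk1 hP) (by positivity)
    · exact kU_sup hkm hhme hk1 hP (heat_sup ht)
  have hhU2 : (c ^ (1 / p.toReal) * N) ^ (1 - θ) * N ^ θ
      = c ^ (p⁻¹.toReal - q⁻¹.toReal) * N := by
    rw [ENNReal.mul_rpow_of_nonneg _ _ (by linarith), mul_assoc,
      ← ENNReal.rpow_add_of_nonneg _ _ (by linarith) hθ0, sub_add_cancel, ENNReal.rpow_one,
      ← ENNReal.rpow_mul]
    congr 2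
    rw [ha, hθ]; field_simp
  have hwc : w t * c ^ (p⁻¹.toReal - q⁻¹.toReal) ≤ 1 := by
    have := weight_le (s := (d:ℝ) / 2) (by positivity) hab.le ht
    rwa [← neg_div] at this
  calc w t * eLpNorm (conv (heatKernel d t) f) q volume
      ≤ w t * (C + c ^ (p⁻¹.toReal - q⁻¹.toReal) * N) := by
        gcongr
        refine hle.trans ((eLpNorm_add_le (kU_meas hkm hge).aestronglyMeasurable
          (kU_meas hkm hhme).aestronglyMeasurable hq1).trans ?_)
        exact add_le_add hgU (hhU.trans hhU2.le)
    _ = w t * C + (w t * c ^ (p⁻¹.toReal - q⁻¹.toReal)) * N := by ring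
    _ ≤ ε / 2 + 1 * (ε / 2) := by gcongr
    _ = ε := by rw [one_mul, ENNReal.add_halves]

end
end

section
/- For every dimension d ∈ ℕ, d ≥ 1, there exists a constant M₀ > 0 such that for every multi-index β ∈ ℕ^d and integers k, m ∈ ℕ with |β| + k > 0 and 0 ≤ m ≤ k, for every 1 ≤ q ≤ ∞ and every t > 0, ‖D_x^β ∂_t^k (t^m G(·,t))‖_{L^q(ℝ^d)} ≤ M₀^{|β|/2 + k} (|β|+k)^{|β|/2 + k + (d/2)(1−1/q)} t^{−(|β|+2(k−m))/2 − (d/2)(1−1/q)}. -/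
open MeasureTheory Real Filter
open scoped ENNReal BigOperators Topology

noncomputable section

inductive Maj {d : ℕ} (R : ℝ) : ℕ → ℝ → (Euc d → ℝ) → Prop
  | const (c : ℝ) (n : ℕ) : Maj R n |c| (fun _ => c)
  | mul (i : Fin d) {n : ℕ} {A : ℝ} {P : Euc d → ℝ} (h : Maj R n A P) :
      Maj R (n + 1) (R * A) (fun y => y i * P y)
  | add {n : ℕ} {A B : ℝ} {P Q : Euc d → ℝ} (h : Maj R n A P) (h' : Maj R n B Q) :
      Maj R n (A + B) (fun y => P y + Q y)
  | mono {n n' : ℕ} {A A' : ℝ} {P : Euc d → ℝ} (hn : n ≤ n') (hA : A ≤ A') (h : Maj R n A P) :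
      Maj R n' A' P

namespace Maj

variable {d : ℕ} {R : ℝ} {n : ℕ} {A : ℝ} {P : Euc d → ℝ}

lemma nonneg (hR : 0 < R) (h : Maj R n A P) : 0 ≤ A := by
  induction h with
  | const c n => positivity
  | mul i h ih => positivity
  | add h h' ih ih' => positivity
  | mono hn hA h ih => linarith

lemma smul (c : ℝ) (h : Maj R n A P) : Maj R n (|c| * A) (fun y => c * P y) := by
  induction h with
  | const c' n => rw [← abs_mul]; exact const _ _
  | @mul i n A P h ih =>
    have := mul i ih
    convert this using 1
    · ring
    · ext y; ring
  | @add n A B P Q h h' ih ih' =>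
    have := add ih ih'
    convert this using 1
    · ring
    · ext y; ring
  | mono hn hA h ih => exact mono hn (by gcongr) ih

lemma diff (h : Maj R n A P) : Differentiable ℝ P := by
  induction h with
  | const c' n => fun_prop
  | mul i h ih => fun_prop
  | add h h' ih ih' => fun_prop
  | mono hn hA h ih => exact ih

lemma fderiv_coord_mul (hP : Differentiable ℝ P) (i : Fin d) (y v : Euc d) :
    fderiv ℝ (fun y : Euc d => y i * P y) y v = v i * P y + y i * fderiv ℝ P y v := by
  have h1 : HasFDerivAt (fun y : Euc d => y i) (EuclideanSpace.proj i : Euc d →L[ℝ] ℝ) y :=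
    (EuclideanSpace.proj i : Euc d →L[ℝ] ℝ).hasFDerivAt
  have h2 := h1.mul (hP y).hasFDerivAt
  have h3 : fderiv ℝ (fun y : Euc d => y i * P y) y = _ := h2.fderiv
  rw [h3]
  simp
  ring

lemma fderiv_add' {Q : Euc d → ℝ} (hP : Differentiable ℝ P) (hQ : Differentiable ℝ Q)
    (y v : Euc d) :
    fderiv ℝ (fun y : Euc d => P y + Q y) y v = fderiv ℝ P y v + fderiv ℝ Q y v := by
  have h3 : fderiv ℝ (fun y : Euc d => P y + Q y) y = _ :=
    ((hP y).hasFDerivAt.add (hQ y).hasFDerivAt).fderiv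
  rw [h3]
  simp

lemma euler (hR : 0 < R) (h : Maj R n A P) :
    Maj R n (n * A) (fun y => fderiv ℝ P y y) := by
  induction h with
  | const c n => 
    refine mono (le_refl n) (A := |(0:ℝ)|) (by simp; positivity) ?_
    simpa using const 0 n
  | @mul i n A P h ih =>
    have := add (mul i h) (mul i ih)
    simp_rw [fderiv_coord_mul h.diff]
    convert this using 1
    push_cast; ring
  | @add n A B P Q h h' ih ih' =>
    simp_rw [fderiv_add' h.diff h'.diff]
    convert add ih ih' using 1
    ring
  | mono hn hA h ih =>
    have := h.nonneg hR
    exact mono hn (by gcongr) ih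

lemma partial_deriv (hR : 0 < R) (i : Fin d) (h : Maj R n A P) :
    Maj R n (n / R * A) (fun y => fderiv ℝ P y (EuclideanSpace.single i 1)) := by
  induction h with
  | const c n =>
    refine mono (le_refl n) (A := |(0:ℝ)|) (by simp; positivity) ?_
    simpa using const 0 n
  | @mul j n A P h ih =>
    have h0 := h.nonneg hR
    simp_rw [fderiv_coord_mul h.diff]
    have h1 : Maj R (n+1) A (fun y => (EuclideanSpace.single i (1:ℝ) : Euc d) j * P y) := by
      refine mono (Nat.le_succ n) ?_ (smul _ h)
      have : |(EuclideanSpace.single i (1:ℝ) : Euc d) j| ≤ 1 := by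
        by_cases hij : j = i <;> simp [hij]
      nlinarith
    convert add h1 (mul j ih) using 1
    field_simp
    push_cast; ring
  | @add n A B P Q h h' ih ih' =>
    simp_rw [fderiv_add' h.diff h'.diff]
    convert add ih ih' using 1
    ring
  | mono hn hA h ih =>
    have := h.nonneg hR
    exact mono hn (by gcongr) ih

lemma sum (f : Fin d → Euc d → ℝ) (s : Finset (Fin d)) (h : ∀ i, Maj R n A (f i)) :
    Maj R n (s.card * A) (fun y => ∑ i ∈ s, f i y) := by
  classical
  induction s using Finset.induction_on with
  | empty => simpa using const (d := d) (R := R) 0 n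
  | insert a s ha ih =>
    simp_rw [Finset.sum_insert ha]
    convert add (h a) ih using 1
    rw [Finset.card_insert_of_notMem ha]; push_cast; ring

lemma normsq (h : Maj R n A P) :
    Maj R (n+2) (d * R ^ 2 * A) (fun y => ‖y‖ ^ 2 * P y) := by
  have := sum (fun i y => y i * (y i * P y)) Finset.univ (fun i => mul i (mul i h))
  convert this using 1
  · simp; ring
  · ext y
    rw [EuclideanSpace.norm_sq_eq, Finset.sum_mul]
    refine Finset.sum_congr rfl fun i _ => ?_
    simp; ring

lemma bound (hR : 0 < R) (h : Maj R n A P) (y : Euc d) : |P y| ≤ A * (1 + ‖y‖ / R) ^ n := by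
  have hy : 0 ≤ ‖y‖ / R := by positivity
  induction h with
  | const c n => exact le_mul_of_one_le_right (abs_nonneg _) (one_le_pow₀ (by linarith))
  | @mul j n A P h ih =>
    have h0 := h.nonneg hR
    rw [abs_mul]
    have h1 : |y j| ≤ R * (1 + ‖y‖ / R) := by
      have : |y j| ≤ ‖y‖ := by simpa using PiLp.norm_apply_le y j
      have h2 : R * (1 + ‖y‖ / R) = R + ‖y‖ := by field_simp
      linarith
    calc _ ≤ (R * (1 + ‖y‖ / R)) * (A * (1 + ‖y‖ / R) ^ n) := by gcongr
      _ = _ := by ring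
  | @add n A B P Q h h' ih ih' =>
    calc _ ≤ |P y| + |Q y| := abs_add_le _ _
      _ ≤ _ := by rw [add_mul]; gcongr
  | @mono n n' A A' P hn hA h ih =>
    have h0 := h.nonneg hR
    refine ih.trans ?_
    have h1 : 1 ≤ 1 + ‖y‖ / R := by linarith
    have h2 : 0 ≤ A' := by linarith
    gcongr

lemma fderiv_gauss (hP : Differentiable ℝ P) (y v : Euc d) :
    HasFDerivAt (fun y : Euc d => P y * Real.exp (-‖y‖ ^ 2))
      (P y • (Real.exp (-‖y‖ ^ 2) • (-((2:ℝ) • innerSL ℝ y))) + Real.exp (-‖y‖ ^ 2) • fderiv ℝ P y) y := by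
  have h1 : HasFDerivAt (fun y : Euc d => ‖y‖ ^ 2) ((2:ℝ) • innerSL ℝ y) y := by
    have := (hasStrictFDerivAt_norm_sq y).hasFDerivAt
    refine this.congr_fderiv ?_
    ext v
    simp [two_smul, two_mul]
  exact (hP y).hasFDerivAt.mul h1.neg.exp

/-- spatial step -/
lemma pd_step (hR : 0 < R) (i : Fin d) (h : Maj R n A P) (hn : (n:ℝ) ≤ R ^ 2) (c κ : ℝ) :
    ∃ Q : Euc d → ℝ, Maj R (n+1) (3 * R * A) Q ∧
      pd i (fun x => κ * (P (c • x) * Real.exp (-‖c • x‖ ^ 2))) =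
        fun x => (κ * c) * (Q (c • x) * Real.exp (-‖c • x‖ ^ 2)) := by
  have h0 := h.nonneg hR
  refine ⟨fun y => fderiv ℝ P y (EuclideanSpace.single i 1) + (-2) * (y i * P y), ?_, ?_⟩
  · refine mono le_rfl ?_ (add (mono (Nat.le_succ n) le_rfl (partial_deriv hR i h)) (smul (-2) (mul i h)))
    have : (n:ℝ) / R ≤ R := by rw [div_le_iff₀ hR]; nlinarith
    have := mul_le_mul_of_nonneg_right this h0
    norm_num
    linarith
  · ext x
    have h1 := fderiv_gauss h.diff (c • x) x
    have h2 : HasFDerivAt (fun x : Euc d => c • x) (c • ContinuousLinearMap.id ℝ (Euc d)) x :=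
      (hasFDerivAt_id x).const_smul c
    have h3 : HasFDerivAt (fun x => κ * (P (c • x) * Real.exp (-‖c • x‖ ^ 2))) _ x :=
      (h1.comp x h2).const_mul κ
    unfold pd
    rw [h3.fderiv]
    simp [EuclideanSpace.inner_single_right]
    ring

lemma pd_iter (hR : 0 < R) (i : Fin d) (c : ℝ) (j : ℕ) (hn : (n:ℝ) + j ≤ R ^ 2) (κ : ℝ) (h : Maj R n A P) :
    ∃ Q : Euc d → ℝ, Maj R (n+j) ((3 * R) ^ j * A) Q ∧
      (pd i)^[j] (fun x => κ * (P (c • x) * Real.exp (-‖c • x‖ ^ 2))) =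
        fun x => (κ * c ^ j) * (Q (c • x) * Real.exp (-‖c • x‖ ^ 2)) := by
  induction j with
  | zero => exact ⟨P, by simpa using h, by simp⟩
  | succ j ih =>
    push_cast at hn
    obtain ⟨Q, hQ, e⟩ := ih (by linarith)
    obtain ⟨Q', hQ', e'⟩ := pd_step hR i hQ (by push_cast; linarith) c (κ * c ^ j)
    refine ⟨Q', ?_, ?_⟩
    · convert hQ' using 1
      all_goals ring
    · rw [Function.iterate_succ_apply', e, e']
      ext x; ring

lemma md_list (hR : 0 < R) (c : ℝ) (β : Fin d → ℕ) (l : List (Fin d))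
    (hn : (n:ℝ) + ((l.map β).sum : ℕ) ≤ R ^ 2) (κ : ℝ) (h : Maj R n A P) :
    ∃ Q : Euc d → ℝ, Maj R (n+(l.map β).sum) ((3 * R) ^ (l.map β).sum * A) Q ∧
      l.foldr (fun i g => (pd i)^[β i] g) (fun x => κ * (P (c • x) * Real.exp (-‖c • x‖ ^ 2))) =
        fun x => (κ * c ^ (l.map β).sum) * (Q (c • x) * Real.exp (-‖c • x‖ ^ 2)) := by
  induction l with
  | nil => exact ⟨P, by simpa using h, by simp⟩
  | cons a l ih =>
    simp only [List.map_cons, List.sum_cons, List.foldr_cons] at hn ⊢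
    push_cast at hn
    obtain ⟨Q, hQ, e⟩ := ih (by push_cast; linarith [(Nat.cast_nonneg (β a) : (0:ℝ) ≤ β a)])
    obtain ⟨Q', hQ', e'⟩ := pd_iter hR a c (β a) (by push_cast; linarith) (κ * c ^ (l.map β).sum) hQ
    refine ⟨Q', ?_, ?_⟩
    · convert hQ' using 1 <;> ring
    · rw [e, e']
      ext x; ring

/-- time step -/
lemma t_step (hR : 0 < R) (b : ℝ) (h : Maj R n A P) :
    ∃ Q : Euc d → ℝ, Maj R (n+2) ((|b| + n / 2 + d * R ^ 2) * A) Q ∧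
      ∀ (x : Euc d) (s : ℝ), 0 < s → 
      HasDerivAt (fun s : ℝ => s ^ b * (P ((s ^ (-(1/2) : ℝ) / 2) • x) * Real.exp (-‖(s ^ (-(1/2) : ℝ) / 2) • x‖ ^ 2)))
        (s ^ (b - 1) * (Q ((s ^ (-(1/2) : ℝ) / 2) • x) * Real.exp (-‖(s ^ (-(1/2) : ℝ) / 2) • x‖ ^ 2))) s := by
  have h0 := h.nonneg hR
  refine ⟨fun y => (b * P y + (-(1/2)) * fderiv ℝ P y y) + ‖y‖ ^ 2 * P y, ?_, ?_⟩
  · refine mono le_rfl ?_ (add (mono (by omega) le_rfl (add (smul b h) (smul (-(1/2)) (euler hR h)))) (normsq h))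
    norm_num [abs_of_pos]
    ring_nf
    rfl
  · intro x s hs
    have h1 := fderiv_gauss h.diff ((s ^ (-(1/2) : ℝ) / 2) • x) x
    have h2 : HasDerivAt (fun s : ℝ => (s ^ (-(1/2) : ℝ) / 2) • x) (((-(1/2)) * s ^ (-(1/2) - 1 : ℝ) / 2) • x) s :=
      ((Real.hasDerivAt_rpow_const (Or.inl hs.ne')).div_const 2).smul_const x
    have h3 := (Real.hasDerivAt_rpow_const (p := b) (Or.inl hs.ne')).mul (h1.comp_hasDerivAt s h2)
    refine h3.congr_deriv ?_
    rw [Real.rpow_sub_one hs.ne', Real.rpow_sub_one hs.ne']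
    simp [norm_smul, mul_pow, sq_abs]
    field_simp
    rw [sq_abs]
    ring

lemma t_iter (hR : 0 < R) (d m : ℕ) (N : ℝ) (hN : 1 ≤ N) (hRN : R ^ 2 = N) (K : ℕ) (hm : m ≤ K) (hK : 2 * (K:ℝ) ≤ N)
    (k : ℕ) (hk : k ≤ K) :
    ∃ Q : Euc d → ℝ, Maj R (2 * k) (((2 + 2 * d) * N) ^ k * (4 * π) ^ (-(d:ℝ)/2)) Q ∧
      ∀ (x : Euc d) (s : ℝ), 0 < s → iteratedDeriv k (fun s => s ^ m * heatKernel d s x) s =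
        s ^ ((m:ℝ) - d / 2 - k) * (Q ((s ^ (-(1/2) : ℝ) / 2) • x) * Real.exp (-‖(s ^ (-(1/2) : ℝ) / 2) • x‖ ^ 2)) := by
  induction k with
  | zero =>
    refine ⟨fun _ => (4 * π) ^ (-(d:ℝ)/2), ?_, ?_⟩
    · have := const (d := d) (R := R) ((4 * π) ^ (-(d:ℝ)/2)) 0
      rw [abs_of_pos (by positivity)] at this
      simpa using this
    · intro x s hs
      simp only [iteratedDeriv_zero, heatKernel]
      have e1 : ‖(s ^ (-(1/2) : ℝ) / 2) • x‖ ^ 2 = ‖x‖ ^ 2 / (4 * s) := by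
        rw [norm_smul, mul_pow, Real.norm_eq_abs, sq_abs, div_pow, ← Real.rpow_natCast, ← Real.rpow_mul hs.le]
        norm_num [Real.rpow_neg_one]
        field_simp
      rw [e1, Real.mul_rpow (by positivity) hs.le, ← Real.rpow_natCast s m]
      have : s ^ ((m:ℝ) - d/2 - (0:ℕ)) = s ^ (m:ℝ) * s ^ (-(d:ℝ)/2) := by
        rw [← Real.rpow_add hs]; congr 1; simp; ring
      rw [this, neg_div]; ring
  | succ k ih =>
    obtain ⟨Q, hQ, e⟩ := ih (by omega)
    obtain ⟨Q', hQ', e'⟩ := t_step hR ((m:ℝ) - d / 2 - k) hQ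
    refine ⟨Q', mono (by omega) ?_ hQ', ?_⟩
    · have h0 := hQ.nonneg hR
      rw [pow_succ ((2 + 2 * (d:ℝ)) * N)]
      have hb : |(m:ℝ) - d / 2 - k| ≤ N + d * N := by
        have h1 : (m:ℝ) ≤ K := by exact_mod_cast hm
        have h2 : (k:ℝ) ≤ K := by exact_mod_cast (by omega : k ≤ K)
        have h3 : (0:ℝ) ≤ d := by positivity
        have h4 : (0:ℝ) ≤ k := by positivity
        have h5 : (0:ℝ) ≤ m := by positivity
        rw [abs_le]; constructor <;> nlinarith
      have hk' : (k:ℝ) ≤ N := by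
        have h2 : (k:ℝ) ≤ K := by exact_mod_cast (by omega : k ≤ K)
        linarith [(Nat.cast_nonneg k : (0:ℝ) ≤ k)]
      have : (|(m:ℝ) - d / 2 - k| + (2 * k : ℕ) / 2 + d * R ^ 2) ≤ (2 + 2 * d) * N := by
        rw [hRN]; push_cast; linarith
      calc _ ≤ ((2 + 2 * d) * N) * (((2 + 2 * d) * N) ^ k * (4 * π) ^ (-(d:ℝ)/2)) := by gcongr
        _ = _ := by ring
    · intro x s hs
      rw [iteratedDeriv_succ]
      have : iteratedDeriv k (fun s => s ^ m * heatKernel d s x) =ᶠ[𝓝 s] fun s =>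
        s ^ ((m:ℝ) - d / 2 - k) * (Q ((s ^ (-(1/2) : ℝ) / 2) • x) * Real.exp (-‖(s ^ (-(1/2) : ℝ) / 2) • x‖ ^ 2)) := by
        filter_upwards [lt_mem_nhds hs] with r hr using e x r hr
      rw [this.deriv_eq, (e' x s hs).deriv]
      congr 2
      push_cast; ring

end Maj

lemma gauss_Lq (d : ℕ) (q : ℝ≥0∞) (hq : 1 ≤ q) (t : ℝ) (ht : 0 < t) :
    eLpNorm (fun x : Euc d => Real.exp (-(1 / (8 * t)) * ‖x‖ ^ 2)) q volume ≤
      ENNReal.ofReal ((8 * π * t) ^ ((d:ℝ) / 2 * q⁻¹.toReal)) := by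
  have hle : ∀ x : Euc d, Real.exp (-(1 / (8 * t)) * ‖x‖ ^ 2) ≤ 1 := by
    intro x
    rw [Real.exp_le_one_iff]
    have : 0 ≤ (1 / (8 * t)) * ‖x‖ ^ 2 := by positivity
    linarith
  have hint : ∫ x : Euc d, Real.exp (-(1 / (8 * t)) * ‖x‖ ^ 2) = (8 * π * t) ^ ((d:ℝ) / 2) := by
    rw [GaussianFourier.integral_rexp_neg_mul_sq_norm (by positivity)]
    simp
    congr 1
    field_simp
  have hI : Integrable (fun x : Euc d => Real.exp (-(1 / (8 * t)) * ‖x‖ ^ 2)) := by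
    by_contra hc
    rw [integral_undef hc] at hint
    have : 0 < (8 * π * t) ^ ((d:ℝ) / 2) := by positivity
    linarith
  by_cases hqt : q = ⊤
  · subst hqt
    simp only [ENNReal.inv_top, ENNReal.toReal_zero, mul_zero, Real.rpow_zero]
    rw [eLpNorm_exponent_top]
    refine eLpNormEssSup_le_of_ae_bound (Eventually.of_forall fun x => ?_)
    rw [Real.norm_eq_abs, Real.abs_exp]; exact hle x
  · have hq0 : q ≠ 0 := by rintro rfl; simp at hq
    have hq1 : 1 ≤ q.toReal := by
      have := ENNReal.toReal_mono hqt hq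
      simpa using this
    rw [eLpNorm_eq_lintegral_rpow_enorm_toReal hq0 hqt]
    have : ∫⁻ x : Euc d, ‖Real.exp (-(1 / (8 * t)) * ‖x‖ ^ 2)‖ₑ ^ q.toReal ≤ ENNReal.ofReal ((8 * π * t) ^ ((d:ℝ) / 2)) := by
      rw [← hint, ofReal_integral_eq_lintegral_ofReal hI (Eventually.of_forall fun x => (Real.exp_pos _).le)]
      refine lintegral_mono fun x => ?_
      have h1 : ‖Real.exp (-(1 / (8 * t)) * ‖x‖ ^ 2)‖ₑ = ENNReal.ofReal (Real.exp (-(1 / (8 * t)) * ‖x‖ ^ 2)) :=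
        Real.enorm_of_nonneg (Real.exp_pos _).le
      rw [h1]
      refine ENNReal.rpow_le_self_of_le_one ?_ hq1
      simpa using hle x
    refine (ENNReal.rpow_le_rpow this (by positivity)).trans ?_
    rw [ENNReal.ofReal_rpow_of_nonneg (by positivity) (by positivity), ← Real.rpow_mul (by positivity), ENNReal.toReal_inv, one_div]

lemma const_bound (d B k : ℕ) (hpos : 0 < B + k) (e : ℝ) (he0 : 0 ≤ e) (he1 : e ≤ 1) :
    (((2 + 2 * (d:ℝ)) * ((B:ℝ) + 2 * k)) ^ k * (4 * π) ^ (-(d:ℝ)/2)) * (3 * √((B:ℝ) + 2 * k)) ^ B *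
      (1/2) ^ B * Real.exp (((B:ℝ) + 2 * k)/2) * (8 * π) ^ ((d:ℝ) / 2 * e) ≤
    ((8 * π) ^ (d:ℝ) * 9 * (2 + 2 * (d:ℝ)) * 2 * Real.exp 1) ^ ((B:ℝ) / 2 + k) *
      ((B:ℝ) + k) ^ ((B:ℝ) / 2 + k + (d:ℝ)/2 * (1 - e)) := by
  have hn : (1:ℝ) ≤ (B:ℝ) + k := by exact_mod_cast hpos
  have hB : (0:ℝ) ≤ B := by positivity
  have hk : (0:ℝ) ≤ k := by positivity
  have hd : (0:ℝ) ≤ d := by positivity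
  have hpi := Real.pi_gt_three
  have hσ : (1/2:ℝ) ≤ (B:ℝ)/2 + k := by linarith
  have hσ0 : (0:ℝ) ≤ (B:ℝ)/2 + k := by linarith
  set N : ℝ := (B:ℝ) + 2 * k with hNdef
  have hN : 1 ≤ N := by linarith
  have hN0 : 0 ≤ N := by linarith
  set σ : ℝ := (B:ℝ)/2 + k with hσdef
  have i1 : (4 * π) ^ (-(d:ℝ)/2) ≤ 1 :=
    Real.rpow_le_one_of_one_le_of_nonpos (by linarith) (by linarith)
  have i2 : (1/2:ℝ) ^ B ≤ 1 := pow_le_one₀ (by norm_num) (by norm_num)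
  have i3 : (8 * π) ^ ((d:ℝ) / 2 * e) ≤ ((8 * π) ^ (d:ℝ)) ^ σ := by
    rw [← Real.rpow_mul (by positivity)]
    refine Real.rpow_le_rpow_of_exponent_le (by linarith) ?_
    nlinarith [mul_nonneg hd (sub_nonneg.2 hσ), mul_nonneg hd (sub_nonneg.2 he1)]
  have i4 : (2 + 2 * (d:ℝ)) ^ k ≤ (2 + 2 * (d:ℝ)) ^ σ := by
    rw [← Real.rpow_natCast]
    exact Real.rpow_le_rpow_of_exponent_le (by linarith) (by linarith)
  have i5 : (3:ℝ) ^ B ≤ 9 ^ σ := by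
    have : (3:ℝ) ^ B = 9 ^ ((B:ℝ)/2) := by
      rw [show (9:ℝ) = 3 ^ (2:ℝ) by norm_num, ← Real.rpow_mul (by norm_num), ← Real.rpow_natCast]
      congr 1; ring
    rw [this]
    exact Real.rpow_le_rpow_of_exponent_le (by norm_num) (by linarith)
  have i6 : N ^ k * √N ^ B = N ^ σ := by
    rw [Real.sqrt_eq_rpow, ← Real.rpow_natCast, ← Real.rpow_natCast (N ^ (1/2:ℝ)), ← Real.rpow_mul hN0,
      ← Real.rpow_add (by linarith)]
    congr 1; rw [hσdef]; ring
  have i7 : N ^ σ ≤ 2 ^ σ * ((B:ℝ) + k) ^ (σ + (d:ℝ)/2 * (1 - e)) := by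
    calc N ^ σ ≤ (2 * ((B:ℝ) + k)) ^ σ := Real.rpow_le_rpow hN0 (by linarith) hσ0
      _ = 2 ^ σ * ((B:ℝ) + k) ^ σ := Real.mul_rpow (by norm_num) (by linarith)
      _ ≤ _ := by
        refine mul_le_mul_of_nonneg_left ?_ (by positivity)
        refine Real.rpow_le_rpow_of_exponent_le hn ?_
        nlinarith [mul_nonneg hd (sub_nonneg.2 he1)]
  have i8 : Real.exp (N/2) = Real.exp 1 ^ σ := by
    rw [Real.exp_one_rpow]; congr 1; rw [hσdef, hNdef]; ring
  have i9 : ((8 * π) ^ (d:ℝ) * 9 * (2 + 2 * (d:ℝ)) * 2 * Real.exp 1) ^ σ =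
      ((8 * π) ^ (d:ℝ)) ^ σ * 9 ^ σ * (2 + 2 * (d:ℝ)) ^ σ * 2 ^ σ * Real.exp 1 ^ σ := by
    rw [Real.mul_rpow (y := Real.exp 1) (by positivity) (by positivity),
      Real.mul_rpow (x := (8 * π) ^ (d:ℝ) * 9 * (2 + 2 * (d:ℝ))) (by positivity) (by positivity),
      Real.mul_rpow (x := (8 * π) ^ (d:ℝ) * 9) (by positivity) (by positivity),
      Real.mul_rpow (x := (8 * π) ^ (d:ℝ)) (by positivity) (by positivity)]
  rw [i9, mul_pow _ N, mul_pow 3, i8]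
  have hD : 0 ≤ 2 + 2 * (d:ℝ) := by positivity
  have j1 : 0 ≤ (4 * π) ^ (-(d:ℝ)/2) := by positivity
  have j2 : 0 ≤ (8 * π) ^ ((d:ℝ) / 2 * e) := by positivity
  have j3 : 0 ≤ ((8 * π) ^ (d:ℝ)) ^ σ := by positivity
  generalize (4 * π) ^ (-(d:ℝ)/2) = a1 at *
  generalize (8 * π) ^ ((d:ℝ) / 2 * e) = a2 at *
  generalize ((8 * π) ^ (d:ℝ)) ^ σ = a3 at *
  generalize 2 + 2 * (d:ℝ) = D at *
  calc _ = (D ^ k) * (N ^ k * √N ^ B) * a1 * 3 ^ B * (1/2) ^ B * Real.exp 1 ^ σ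
        * a2 := by ring
    _ ≤ (D ^ σ) * (2 ^ σ * ((B:ℝ) + k) ^ (σ + (d:ℝ)/2 * (1 - e))) * 1 * 9 ^ σ * 1 * Real.exp 1 ^ σ
        * a3 := by
      rw [i6]; gcongr
    _ = _ := by ring

/-- space-time derivative estimates for `t^m G(·,t)`. -/
theorem heatKernel_spacetime_deriv_Lq_bound (d : ℕ) (hd : 1 ≤ d) :
    ∃ M₀ : ℝ, 0 < M₀ ∧
      ∀ (β : Fin d → ℕ) (k m : ℕ), 0 < msize β + k → m ≤ k →
        ∀ (q : ℝ≥0∞), 1 ≤ q → ∀ t : ℝ, 0 < t →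
          eLpNorm (mderiv β (tderiv k (fun s x => s ^ m * heatKernel d s x) t)) q volume ≤
            ENNReal.ofReal
              (M₀ ^ ((msize β : ℝ) / 2 + (k : ℝ)) *
                ((msize β : ℝ) + (k : ℝ)) ^
                  ((msize β : ℝ) / 2 + (k : ℝ) + ((d : ℝ) / 2) * (1 - q⁻¹.toReal)) *
                t ^ (-(((msize β : ℝ) + 2 * ((k : ℝ) - (m : ℝ))) / 2) -
                      ((d : ℝ) / 2) * (1 - q⁻¹.toReal))) := by
  have hpi := Real.pi_gt_three
  refine ⟨(8 * π) ^ (d:ℝ) * 9 * (2 + 2 * (d:ℝ)) * 2 * Real.exp 1, by positivity, ?_⟩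
  intro β k m hpos hmk q hq t ht
  have hn : (1:ℝ) ≤ (msize β:ℝ) + k := by exact_mod_cast hpos
  have hB : (0:ℝ) ≤ msize β := by positivity
  have hk : (0:ℝ) ≤ k := by positivity
  have he0 : 0 ≤ q⁻¹.toReal := ENNReal.toReal_nonneg
  have he1 : q⁻¹.toReal ≤ 1 := by
    have := ENNReal.toReal_mono ENNReal.one_ne_top (ENNReal.inv_le_one.2 hq)
    simpa using this
  have hN : 1 ≤ (msize β:ℝ) + 2 * k := by linarith
  have hR : 0 < √((msize β:ℝ) + 2 * k) := Real.sqrt_pos.2 (by linarith)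
  have hRN : √((msize β:ℝ) + 2 * k) ^ 2 = (msize β:ℝ) + 2 * k := Real.sq_sqrt (by linarith)
  have hcb := const_bound d (msize β) k hpos q⁻¹.toReal he0 he1
  obtain ⟨P, hP, e⟩ := Maj.t_iter hR d m _ hN hRN k hmk (by linarith) k le_rfl
  have hsum : ((List.finRange d).map β).sum = msize β := by
    rw [msize, Fin.sum_univ_def]
  obtain ⟨Q, hQ, e'⟩ := Maj.md_list hR (t ^ (-(1/2) : ℝ) / 2) β (List.finRange d)
    (by rw [hsum, hRN]; push_cast; linarith) (t ^ ((m:ℝ) - d / 2 - k)) hP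
  rw [hsum] at hQ e'
  have e1 : tderiv k (fun s x => s ^ m * heatKernel d s x) t = fun x =>
      t ^ ((m:ℝ) - d / 2 - k) * (P ((t ^ (-(1/2) : ℝ) / 2) • x) *
        Real.exp (-‖(t ^ (-(1/2) : ℝ) / 2) • x‖ ^ 2)) := by
    ext x; exact e x t ht
  rw [mderiv, e1, e']
  set N : ℝ := (msize β:ℝ) + 2 * k with hNdef
  set A : ℝ := ((2 + 2 * (d:ℝ)) * N) ^ k * (4 * π) ^ (-(d:ℝ)/2) with hA
  set c : ℝ := t ^ (-(1/2) : ℝ) / 2 with hc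
  have hA0 : 0 ≤ A := by rw [hA]; positivity
  have hc0 : 0 < c := by rw [hc]; positivity
  set κ : ℝ := t ^ ((m:ℝ) - d / 2 - k) * c ^ msize β with hκ
  have hκ0 : 0 < κ := by positivity
  set C : ℝ := κ * ((3 * √N) ^ msize β * A * Real.exp (N / 2)) with hC
  have hC0 : 0 ≤ C := by positivity
  have hpt : ∀ x : Euc d, ‖κ * (Q (c • x) * Real.exp (-‖c • x‖ ^ 2))‖ ≤
      C * ‖Real.exp (-(1 / (8 * t)) * ‖x‖ ^ 2)‖ := by
    intro x
    have ex : -(1 / (8 * t)) * ‖x‖ ^ 2 = - ‖c • x‖ ^ 2 / 2 := by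
      rw [norm_smul, mul_pow, Real.norm_eq_abs, sq_abs, hc, div_pow, ← Real.rpow_natCast (t ^ _),
        ← Real.rpow_mul ht.le]
      norm_num [Real.rpow_neg_one]
      field_simp
      ring
    rw [ex]
    have hb := hQ.bound hR (c • x)
    set y := c • x
    have h1 : (1 + ‖y‖ / √N) ^ (2 * k + msize β) ≤ Real.exp (√N * ‖y‖) := by
      calc (1 + ‖y‖ / √N) ^ (2 * k + msize β) ≤ Real.exp (‖y‖ / √N) ^ (2 * k + msize β) := by
            gcongr
            rw [add_comm]; exact Real.add_one_le_exp _
        _ = Real.exp (√N * ‖y‖) := by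
            rw [← Real.exp_nat_mul]
            congr 1
            push_cast
            rw [add_comm, ← hNdef]
            field_simp
            rw [hRN, mul_comm]
    have h2 : √N * ‖y‖ + -‖y‖ ^ 2 ≤ N / 2 + -‖y‖ ^ 2 / 2 := by
      nlinarith [sq_nonneg (√N - ‖y‖)]
    rw [Real.norm_eq_abs, Real.norm_eq_abs, abs_mul κ, abs_mul (Q y), abs_of_pos hκ0, Real.abs_exp,
      Real.abs_exp, hC, mul_assoc κ]
    refine mul_le_mul_of_nonneg_left ?_ hκ0.le
    calc |Q y| * Real.exp (-‖y‖ ^ 2)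
        ≤ ((3 * √N) ^ msize β * A * Real.exp (√N * ‖y‖)) * Real.exp (-‖y‖ ^ 2) := by
          gcongr
          exact hb.trans (by gcongr)
      _ = (3 * √N) ^ msize β * A * Real.exp (√N * ‖y‖ + -‖y‖ ^ 2) := by rw [Real.exp_add]; ring
      _ ≤ (3 * √N) ^ msize β * A * Real.exp (N / 2 + -‖y‖ ^ 2 / 2) := by gcongr
      _ = _ := by rw [Real.exp_add]; ring
  refine (eLpNorm_le_mul_eLpNorm_of_ae_le_mul (Eventually.of_forall hpt) q).trans ?_
  refine (mul_le_mul_right (gauss_Lq d q hq t ht) _).trans ?_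
  rw [← ENNReal.ofReal_mul hC0]
  refine ENNReal.ofReal_le_ofReal ?_
  have hT : t ^ ((m:ℝ) - d / 2 - k) * (t ^ (-(1/2) : ℝ)) ^ msize β * t ^ ((d:ℝ) / 2 * q⁻¹.toReal) =
      t ^ (-(((msize β : ℝ) + 2 * ((k : ℝ) - (m : ℝ))) / 2) -
                      ((d : ℝ) / 2) * (1 - q⁻¹.toReal)) := by
    rw [← Real.rpow_natCast (t ^ _), ← Real.rpow_mul ht.le, ← Real.rpow_add ht, ← Real.rpow_add ht]
    congr 1; ring
  rw [← hT, Real.mul_rpow (by positivity) ht.le]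
  refine le_trans (le_of_eq ?_) (mul_le_mul_of_nonneg_right hcb (by positivity))
  rw [hC, hκ, hc, div_pow, one_div, inv_pow]
  ring

end
end
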